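/- arXiv:1911.06062 — 6 statements merged into one kernel-verified Lean document; each statement's English description precedes it below -/
import Mathlib

section
/- For every real p > 2, the derivative g_p' is injective on the open interval (0, (1/4)^(1/p)); moreover, for every real p > 9/2 there exists v ∈ (0, (1/4)^(1/p)) with g_p'(v) = −2π/3. -/
open Real

/-- `r₋(v) = (1/2 − √(1/4 − v^p))^(1/p)`. -/
noncomputable def rMinus (p v : ℝ) : ℝ := (1 / 2 - Real.sqrt (1 / 4 - v ^ p)) ^ (1 / p)

/-- `r₊(v) = (1/2 + √(1/4 − v^p))^(1/p)`. -/
noncomputable def rPlus (p v : ℝ) : ℝ := (1 / 2 + Real.sqrt (1 / 4 - v ^ p)) ^ (1 / p)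

/-- `g_p(v) = 2∫_{r₋(v)}^{r₊(v)} √((1 − r^p)^(2/p) − v²/r²) dr`. -/
noncomputable def g (p v : ℝ) : ℝ :=
  2 * ∫ r in rMinus p v..rPlus p v, Real.sqrt ((1 - r ^ p) ^ (2 / p) - v ^ 2 / r ^ 2)

open MeasureTheory Set

lemma lintegral_Ioo_eq_of_strictMonoOn {f f' : ℝ → ℝ} {a b : ℝ} (hab : a ≤ b)
    (hc : ContinuousOn f (Icc a b)) (hm : StrictMonoOn f (Icc a b))
    (hd : ∀ x ∈ Ioo a b, HasDerivAt f (f' x) x) (φ : ℝ → ENNReal) :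
    ∫⁻ y in Ioo (f a) (f b), φ y = ∫⁻ x in Ioo a b, ENNReal.ofReal (f' x) * φ (f x) := by
  have him : f '' Ioo a b = Ioo (f a) (f b) := by
    refine Subset.antisymm ?_ (intermediate_value_Ioo hab hc)
    rintro _ ⟨x, hx, rfl⟩
    exact ⟨hm (left_mem_Icc.2 hab) (Ioo_subset_Icc_self hx) hx.1,
      hm (Ioo_subset_Icc_self hx) (right_mem_Icc.2 hab) hx.2⟩
  rw [← him]
  exact lintegral_image_eq_lintegral_deriv_mul_of_monotoneOn measurableSet_Ioo
    (fun x hx => (hd x hx).hasDerivWithinAt) (hm.monotoneOn.mono Ioo_subset_Icc_self) φ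

lemma lintegral_Ioo_eq_of_strictAntiOn {f f' : ℝ → ℝ} {a b : ℝ} (hab : a ≤ b)
    (hc : ContinuousOn f (Icc a b)) (hm : StrictAntiOn f (Icc a b))
    (hd : ∀ x ∈ Ioo a b, HasDerivAt f (f' x) x) (φ : ℝ → ENNReal) :
    ∫⁻ y in Ioo (f b) (f a), φ y = ∫⁻ x in Ioo a b, ENNReal.ofReal (-f' x) * φ (f x) := by
  have him : f '' Ioo a b = Ioo (f b) (f a) := by
    refine Subset.antisymm ?_ (intermediate_value_Ioo' hab hc)
    rintro _ ⟨x, hx, rfl⟩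
    exact ⟨hm (Ioo_subset_Icc_self hx) (right_mem_Icc.2 hab) hx.2,
      hm (left_mem_Icc.2 hab) (Ioo_subset_Icc_self hx) hx.1⟩
  rw [← him]
  exact lintegral_image_eq_lintegral_deriv_mul_of_antitoneOn measurableSet_Ioo
    (fun x hx => (hd x hx).hasDerivWithinAt) (hm.antitoneOn.mono Ioo_subset_Icc_self) φ

lemma ofReal_sqrt_sq_sub_sq {v w : ℝ} (hv : 0 < v) (hw : v < w) :
    ENNReal.ofReal (√(w ^ 2 - v ^ 2)) =
      ∫⁻ t in Ioo v w, ENNReal.ofReal (t / √(w ^ 2 - t ^ 2)) := by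
  have h := lintegral_Ioo_eq_of_strictMonoOn (f := fun t => -√(w ^ 2 - t ^ 2))
    (f' := fun t => t / √(w ^ 2 - t ^ 2)) hw.le (by fun_prop) ?_ ?_ (fun _ => 1)
  · simpa using h
  · intro x hx y hy hxy
    have : 0 < x := hv.trans_le hx.1
    exact neg_lt_neg (Real.sqrt_lt_sqrt (by nlinarith [hy.2]) (by nlinarith))
  · intro x hx
    have h0 : 0 < w ^ 2 - x ^ 2 := by nlinarith [hx.1, hx.2]
    have h1 := (((hasDerivAt_pow 2 x).const_sub (w ^ 2)).sqrt h0.ne').neg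
    refine h1.congr_deriv ?_
    field_simp
    simp

lemma four_inv_rpow {p : ℝ} (hp : 0 < p) : ((1 / 4 : ℝ) ^ (1 / p)) ^ p = 1 / 4 := by
  rw [← Real.rpow_mul (by norm_num), one_div_mul_cancel hp.ne', Real.rpow_one]

lemma rpow_le_quarter {p w : ℝ} (hp : 0 < p) (hw : 0 ≤ w) (h : w ≤ (1 / 4 : ℝ) ^ (1 / p)) :
    w ^ p ≤ 1 / 4 :=
  four_inv_rpow hp ▸ Real.rpow_le_rpow hw h hp.le

lemma rpow_lt_quarter {p w : ℝ} (hp : 0 < p) (hw : 0 ≤ w) (h : w < (1 / 4 : ℝ) ^ (1 / p)) :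
    w ^ p < 1 / 4 :=
  four_inv_rpow hp ▸ Real.rpow_lt_rpow hw h hp

lemma sqrt_quarter_sub_lt {x : ℝ} (hx : 0 < x) : √(1 / 4 - x) < 1 / 2 :=
  (Real.sqrt_lt' (by norm_num)).2 (by linarith)

/-- The integrand of `g` at `r = s ^ (1 / p)` where `s (1 - s) = w ^ p`. -/
lemma sqrt_integrand_eq {p s w v : ℝ} (hp : 0 < p) (hs : 0 < s) (hs' : 0 < 1 - s) (hw : 0 < w)
    (h : s * (1 - s) = w ^ p) :
    √((1 - (s ^ (1 / p)) ^ p) ^ (2 / p) - v ^ 2 / (s ^ (1 / p)) ^ 2) =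
      √(w ^ 2 - v ^ 2) / s ^ (1 / p) := by
  have h1 : (s ^ (1 / p)) ^ p = s := by
    rw [← Real.rpow_mul hs.le, one_div_mul_cancel hp.ne', Real.rpow_one]
  have h2 : s ^ (1 / p) * (1 - s) ^ (1 / p) = w := by
    rw [← Real.mul_rpow hs.le hs'.le, h, ← Real.rpow_mul hw.le, mul_one_div_cancel hp.ne',
      Real.rpow_one]
  have h3 : (1 - s) ^ (2 / p) = ((1 - s) ^ (1 / p)) ^ 2 := by
    rw [← Real.rpow_natCast, ← Real.rpow_mul hs'.le]; congr 1; push_cast; ring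
  have h4 : 0 < s ^ (1 / p) := Real.rpow_pos_of_pos hs _
  generalize s ^ (1 / p) = R at *
  have h5 : √(w ^ 2 - v ^ 2) / R = √((w ^ 2 - v ^ 2) / R ^ 2) := by
    rw [Real.sqrt_div' _ (by positivity), Real.sqrt_sq h4.le]
  rw [h5, h1, h3, ← h2]
  congr 1
  field_simp

lemma ofReal_fold_eq {p w S s t R T Q : ℝ} (hp : 0 < p) (hw : 0 < w) (hS : 0 < S) (hs : 0 < s)
    (ht : 0 < t) (hR : 0 < R) (hT : 0 < T) (hQ : 0 ≤ Q) (h : s + t = 1) :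
    ENNReal.ofReal (p * (s * t / w) / (2 * S) * (1 / p) * (R / s)) * ENNReal.ofReal (Q / R) +
      ENNReal.ofReal (-(-(p * (s * t / w) / (2 * S)) * (1 / p) * (T / t))) *
        ENNReal.ofReal (Q / T) = ENNReal.ofReal (Q * (w * (2 * S))⁻¹) := by
  simp only [neg_mul, neg_neg]
  rw [← ENNReal.ofReal_mul (by positivity), ← ENNReal.ofReal_mul (by positivity),
    ← ENNReal.ofReal_add (by positivity) (by positivity)]
  congr 1
  field_simp
  linear_combination Q * h

lemma hasDerivAt_sqrt_quarter_sub_rpow {p w : ℝ} (hw : 0 < w) (h : w ^ p < 1 / 4) :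
    HasDerivAt (fun w : ℝ => √(1 / 4 - w ^ p))
      (-(p * w ^ (p - 1) / (2 * √(1 / 4 - w ^ p)))) w := by
  have := ((Real.hasDerivAt_rpow_const (p := p) (Or.inl hw.ne')).const_sub (1 / 4)).sqrt
    (sub_pos.2 h).ne'
  exact this.congr_deriv (by ring)

lemma lintegral_integrand_eq {p v : ℝ} (hp : 0 < p) (hv : 0 < v)
    (hvV : v < (1 / 4 : ℝ) ^ (1 / p)) :
    ∫⁻ r in Ioo (rMinus p v) (rPlus p v),
      ENNReal.ofReal (√((1 - r ^ p) ^ (2 / p) - v ^ 2 / r ^ 2)) =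
    ∫⁻ w in Ioo v ((1 / 4 : ℝ) ^ (1 / p)),
      ENNReal.ofReal (√(w ^ 2 - v ^ 2) * (w * √(1 - 4 * w ^ p))⁻¹) := by
  set V : ℝ := (1 / 4 : ℝ) ^ (1 / p) with hV
  set φ : ℝ → ENNReal := fun r => ENNReal.ofReal (√((1 - r ^ p) ^ (2 / p) - v ^ 2 / r ^ 2))
    with hφ
  have hpos : ∀ w ∈ Icc v V, 0 < w := fun w hw => hv.trans_le hw.1
  have hle : ∀ w ∈ Icc v V, w ^ p ≤ 1 / 4 := fun w hw => rpow_le_quarter hp (hpos w hw).le hw.2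
  have hlt : ∀ w ∈ Ioo v V, w ^ p < 1 / 4 := fun w hw =>
    rpow_lt_quarter hp (hv.trans hw.1).le hw.2
  have hp' : 0 < 1 / p := by positivity
  have hcs : ContinuousOn (fun w : ℝ => √(1 / 4 - w ^ p)) (Icc v V) :=
    (continuousOn_const.sub (continuousOn_id.rpow_const fun w hw => Or.inl (hpos w hw).ne')).sqrt
  have hanti : StrictAntiOn (fun w : ℝ => √(1 / 4 - w ^ p)) (Icc v V) := fun x hx y hy hxy =>
    Real.sqrt_lt_sqrt (sub_nonneg.2 (hle y hy))
      (sub_lt_sub_left (Real.rpow_lt_rpow (hpos x hx).le hxy hp) _)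
  have hsm : ∀ w ∈ Icc v V, 0 < 1 / 2 - √(1 / 4 - w ^ p) := fun w hw =>
    sub_pos.2 (sqrt_quarter_sub_lt (Real.rpow_pos_of_pos (hpos w hw) _))
  have hsp : ∀ w, 0 < 1 / 2 + √(1 / 4 - w ^ p) := fun w => by positivity
  have hprod : ∀ w ∈ Icc v V,
      (1 / 2 - √(1 / 4 - w ^ p)) * (1 / 2 + √(1 / 4 - w ^ p)) = w ^ p := fun w hw => by
    have := Real.sq_sqrt (sub_nonneg.2 (hle w hw)); linear_combination -this
  have hminus := lintegral_Ioo_eq_of_strictMonoOn (f := rMinus p)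
    (f' := fun w => (p * w ^ (p - 1) / (2 * √(1 / 4 - w ^ p))) * (1 / p) *
      (1 / 2 - √(1 / 4 - w ^ p)) ^ (1 / p - 1)) hvV.le
    ((continuousOn_const.sub hcs).rpow_const fun w hw => Or.inl (hsm w hw).ne')
    (fun x hx y hy hxy => Real.rpow_lt_rpow (hsm x hx).le
      (sub_lt_sub_left (hanti hx hy hxy) _) hp')
    (fun w hw => by
      have := ((hasDerivAt_sqrt_quarter_sub_rpow (hv.trans hw.1) (hlt w hw)).const_sub
        (1 / 2)).rpow_const (p := 1 / p) (Or.inl (hsm w (Ioo_subset_Icc_self hw)).ne')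
      rwa [neg_neg] at this) φ
  have hplus := lintegral_Ioo_eq_of_strictAntiOn (f := rPlus p)
    (f' := fun w => (-(p * w ^ (p - 1) / (2 * √(1 / 4 - w ^ p)))) * (1 / p) *
      (1 / 2 + √(1 / 4 - w ^ p)) ^ (1 / p - 1)) hvV.le
    ((continuousOn_const.add hcs).rpow_const fun w hw => Or.inl (hsp w).ne')
    (fun x hx y hy hxy => Real.rpow_lt_rpow (hsp y).le
      (by have := hanti hx hy hxy; dsimp only at this; linarith) hp')
    (fun w hw => ((hasDerivAt_sqrt_quarter_sub_rpow (hv.trans hw.1) (hlt w hw)).const_add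
        (1 / 2)).rpow_const (p := 1 / p) (Or.inl (hsp w).ne')) φ
  have hVV : rPlus p V = rMinus p V := by
    simp only [rPlus, rMinus, hV, four_inv_rpow hp]; simp
  have hm1 : rMinus p v < rMinus p V := Real.rpow_lt_rpow (hsm v (left_mem_Icc.2 hvV.le)).le
      (sub_lt_sub_left (hanti (left_mem_Icc.2 hvV.le) (right_mem_Icc.2 hvV.le) hvV) _) hp'
  have hp1 : rMinus p V < rPlus p v := hVV ▸ Real.rpow_lt_rpow (hsp V).le
      (by have := hanti (left_mem_Icc.2 hvV.le) (right_mem_Icc.2 hvV.le) hvV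
          dsimp only at this; linarith) hp'
  have hsplit : ∫⁻ r in Ioo (rMinus p v) (rPlus p v), φ r =
      (∫⁻ r in Ioo (rMinus p v) (rMinus p V), φ r) +
        ∫⁻ r in Ioo (rPlus p V) (rPlus p v), φ r := by
    rw [hVV, setLIntegral_congr (Ioo_ae_eq_Ioc (a := rMinus p v) (b := rMinus p V)),
      ← Ioc_union_Ioo_eq_Ioo hm1.le hp1, lintegral_union measurableSet_Ioo]
    exact Set.disjoint_left.2 fun x hx hx' => not_lt.2 hx.2 hx'.1
  rw [hsplit, hminus, hplus, ← lintegral_add_left]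
  · refine setLIntegral_congr_fun measurableSet_Ioo fun w hw => ?_
    have hwI := Ioo_subset_Icc_self hw
    have hw0 := hpos w hwI
    have hS : 0 < √(1 / 4 - w ^ p) := Real.sqrt_pos.2 (sub_pos.2 (hlt w hw))
    have hE : √(1 - 4 * w ^ p) = 2 * √(1 / 4 - w ^ p) := by
      rw [show 1 - 4 * w ^ p = 2 ^ 2 * (1 / 4 - w ^ p) by ring, Real.sqrt_mul (by norm_num),
        Real.sqrt_sq (by norm_num)]
    have h1 := hsm w hwI
    have h2 := hsp w
    have hwp : w ^ (p - 1) = (1 / 2 - √(1 / 4 - w ^ p)) * (1 / 2 + √(1 / 4 - w ^ p)) / w := by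
      rw [hprod w hwI, Real.rpow_sub hw0, Real.rpow_one]
    have e1 := sqrt_integrand_eq (v := v) hp h1
      (by linarith) hw0 (by linear_combination hprod w hwI)
    have e2 := sqrt_integrand_eq (v := v) hp h2
      (by linarith) hw0 (by linear_combination hprod w hwI)
    simp only [hφ, rMinus, rPlus]
    rw [e1, e2, hE, hwp, Real.rpow_sub h1, Real.rpow_sub h2, Real.rpow_one, Real.rpow_one]
    exact ofReal_fold_eq hp hw0 hS h1 h2 (Real.rpow_pos_of_pos h1 _) (Real.rpow_pos_of_pos h2 _)
      (Real.sqrt_nonneg _) (by ring)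
  · simp only [hφ, rMinus]
    fun_prop

lemma lintegral_Ioo_Ioo_swap {v V : ℝ} {k : ℝ → ℝ → ENNReal}
    (hk : Measurable (Function.uncurry k)) :
    ∫⁻ w in Ioo v V, ∫⁻ t in Ioo v w, k w t = ∫⁻ t in Ioo v V, ∫⁻ w in Ioo t V, k w t := by
  have hS : MeasurableSet {z : ℝ × ℝ | z.2 < z.1} := measurableSet_lt measurable_snd measurable_fst
  have h1 : ∀ w ∈ Ioo v V, ∫⁻ t in Ioo v w, k w t =
      ∫⁻ t in Ioo v V, {z : ℝ × ℝ | z.2 < z.1}.indicator (Function.uncurry k) (w, t) := by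
    intro w hw
    have : Ioo v w = Iio w ∩ Ioo v V := by
      ext t; simp only [mem_Ioo, mem_inter_iff, mem_Iio]
      exact ⟨fun h => ⟨h.2, h.1, h.2.trans hw.2⟩, fun h => ⟨h.2.1, h.1⟩⟩
    rw [this, ← setLIntegral_indicator measurableSet_Iio]
    rfl
  have h2 : ∀ t ∈ Ioo v V, ∫⁻ w in Ioo t V, k w t =
      ∫⁻ w in Ioo v V, {z : ℝ × ℝ | z.2 < z.1}.indicator (Function.uncurry k) (w, t) := by
    intro t ht
    have : Ioo t V = Ioi t ∩ Ioo v V := by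
      ext w; simp only [mem_Ioo, mem_inter_iff, mem_Ioi]
      exact ⟨fun h => ⟨h.1, ht.1.trans h.1, h.2⟩, fun h => ⟨h.1, h.2.2⟩⟩
    rw [this, ← setLIntegral_indicator measurableSet_Ioi]
    rfl
  rw [setLIntegral_congr_fun measurableSet_Ioo h1, setLIntegral_congr_fun measurableSet_Ioo h2]
  exact lintegral_lintegral_swap (hk.indicator hS).aemeasurable

lemma lintegral_sqrt_mul_eq {v V : ℝ} (hv : 0 < v) {m : ℝ → ℝ} (hm : Measurable m) :
    ∫⁻ w in Ioo v V, ENNReal.ofReal (√(w ^ 2 - v ^ 2) * m w) =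
      ∫⁻ t in Ioo v V, ∫⁻ w in Ioo t V,
        ENNReal.ofReal (t / √(w ^ 2 - t ^ 2)) * ENNReal.ofReal (m w) := by
  rw [← lintegral_Ioo_Ioo_swap
    (k := fun w t => ENNReal.ofReal (t / √(w ^ 2 - t ^ 2)) * ENNReal.ofReal (m w))
    (by simp only [Function.uncurry_def]; fun_prop)]
  refine setLIntegral_congr_fun measurableSet_Ioo fun w hw => ?_
  rw [lintegral_mul_const _ (by fun_prop), ← ofReal_sqrt_sq_sub_sq hv hw.1,
    ENNReal.ofReal_mul (Real.sqrt_nonneg _)]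

/-- The slope of `y ↦ y ^ (p / 2)` between `1` and `x`. -/
noncomputable def powSlope (p x : ℝ) : ℝ := dslope (fun y : ℝ => y ^ (p / 2)) 1 x

/-- `c² / (cos² φ + c² sin² φ)`, the value of `(w / V)²` in the angular variable `φ`. -/
noncomputable def ratioSq (c φ : ℝ) : ℝ := c ^ 2 / (cos φ ^ 2 + c ^ 2 * sin φ ^ 2)

/-- The integral expressing `-g' / 2` as a function of `c = v / V`. -/
noncomputable def angularIntegral (p c : ℝ) : ℝ :=
  ∫ φ in 0..(π / 2), (√(powSlope p (ratioSq c φ)))⁻¹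

lemma powSlope_of_ne {p x : ℝ} (hx : x ≠ 1) : powSlope p x = (1 - x ^ (p / 2)) / (1 - x) := by
  rw [powSlope, dslope_of_ne _ hx, slope_def_field, Real.one_rpow, ← neg_div_neg_eq]
  congr 1 <;> ring

lemma powSlope_one (p : ℝ) : powSlope p 1 = p / 2 := by
  rw [powSlope, dslope_same, Real.deriv_rpow_const]
  simp

lemma powSlope_zero {p : ℝ} (hp : 0 < p) : powSlope p 0 = 1 := by
  rw [powSlope_of_ne zero_ne_one, Real.zero_rpow (by positivity)]; simp

lemma continuous_powSlope {p : ℝ} (hp : 0 < p) : Continuous (powSlope p) := by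
  have h : ContinuousOn (dslope (fun y : ℝ => y ^ (p / 2)) 1) univ :=
    (continuousOn_dslope Filter.univ_mem).2
      ⟨(Real.continuous_rpow_const (by positivity)).continuousOn,
        (Real.hasDerivAt_rpow_const (Or.inl one_ne_zero)).differentiableAt⟩
  exact continuousOn_univ.1 h

lemma powSlope_lt_powSlope {p x y : ℝ} (hp : 2 < p) (hx : 0 ≤ x) (hxy : x < y) (hy : y < 1) :
    powSlope p x < powSlope p y := by
  have := (strictConvexOn_rpow (p := p / 2) (by linarith)).secant_strict_mono (a := 1) (x := x)
    (y := y) (by simp) hx (hx.trans hxy.le) (hxy.trans hy).ne hy.ne hxy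
  rw [powSlope, powSlope, dslope_of_ne _ (hxy.trans hy).ne, dslope_of_ne _ hy.ne,
    slope_def_field, slope_def_field]
  exact this

lemma one_le_powSlope {p x : ℝ} (hp : 2 < p) (hx : 0 ≤ x) (hx1 : x ≤ 1) : 1 ≤ powSlope p x := by
  rcases hx1.eq_or_lt with rfl | h1
  · rw [powSlope_one]; linarith
  rcases hx.eq_or_lt with rfl | h0
  · rw [powSlope_zero (by linarith)]
  · rw [← powSlope_zero (p := p) (by linarith)]
    exact (powSlope_lt_powSlope hp le_rfl h0 h1).le

lemma ratioSq_denom_pos {c : ℝ} (hc : 0 < c) (φ : ℝ) : 0 < cos φ ^ 2 + c ^ 2 * sin φ ^ 2 := by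
  by_cases h : sin φ = 0
  · have := sin_sq_add_cos_sq φ
    rw [h] at this ⊢
    nlinarith
  · positivity

lemma ratioSq_nonneg (c φ : ℝ) : 0 ≤ ratioSq c φ := by unfold ratioSq; positivity

lemma ratioSq_le_one {c : ℝ} (hc : c ∈ Icc (0 : ℝ) 1) (φ : ℝ) : ratioSq c φ ≤ 1 := by
  refine div_le_one_of_le₀ ?_ (by positivity)
  nlinarith [sin_sq_add_cos_sq φ, mul_nonneg (sq_nonneg (cos φ))
    (show 0 ≤ 1 - c ^ 2 by nlinarith [hc.1, hc.2])]

lemma continuous_ratioSq {c : ℝ} (hc : 0 < c) : Continuous (ratioSq c) := by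
  unfold ratioSq
  exact continuous_const.div (by fun_prop) fun φ => (ratioSq_denom_pos hc φ).ne'

lemma continuous_angularIntegrand {p c : ℝ} (hp : 2 < p) (hc : c ∈ Ioc (0 : ℝ) 1) :
    Continuous fun φ => (√(powSlope p (ratioSq c φ)))⁻¹ := by
  refine (((continuous_powSlope (by linarith)).comp (continuous_ratioSq hc.1)).sqrt).inv₀ fun φ => ?_
  have := one_le_powSlope hp (ratioSq_nonneg c φ) (ratioSq_le_one (Ioc_subset_Icc_self hc) φ)
  exact (Real.sqrt_pos.2 (by dsimp only [Function.comp]; linarith)).ne'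

lemma angularIntegral_strictAntiOn {p : ℝ} (hp : 2 < p) :
    StrictAntiOn (angularIntegral p) (Ioo 0 1) := by
  intro c hc d hd hcd
  have hcI := Ioo_subset_Ioc_self hc
  have hdI := Ioo_subset_Ioc_self hd
  have key : ∀ φ, cos φ ≠ 0 → (√(powSlope p (ratioSq d φ)))⁻¹ < (√(powSlope p (ratioSq c φ)))⁻¹ := by
    intro φ hφ
    have h1 := one_le_powSlope hp (ratioSq_nonneg c φ) (ratioSq_le_one (Ioc_subset_Icc_self hcI) φ)
    refine inv_strictAnti₀ (Real.sqrt_pos.2 (by linarith)) (Real.sqrt_lt_sqrt (by linarith) ?_)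
    have hC : 0 < cos φ ^ 2 := by positivity
    have hcd2 : c ^ 2 < d ^ 2 := by nlinarith [hc.1]
    have hd2 : d ^ 2 < 1 := by nlinarith [hd.1, hd.2]
    refine powSlope_lt_powSlope hp (ratioSq_nonneg c φ) ?_ ?_
    · rw [ratioSq, ratioSq, div_lt_div_iff₀ (ratioSq_denom_pos hc.1 φ) (ratioSq_denom_pos hd.1 φ)]
      nlinarith
    · rw [ratioSq, div_lt_one (ratioSq_denom_pos hd.1 φ)]
      nlinarith [sin_sq_add_cos_sq φ]
  refine intervalIntegral.integral_lt_integral_of_continuousOn_of_le_of_exists_lt (by positivity)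
    (continuous_angularIntegrand hp hdI).continuousOn (continuous_angularIntegrand hp hcI).continuousOn
    (fun φ hφ => ?_) ⟨0, ⟨le_rfl, by positivity⟩, key 0 (by simp)⟩
  rcases hφ.2.eq_or_lt with rfl | h
  · simp [ratioSq, hc.1.ne', hd.1.ne']
  · exact (key φ (cos_pos_of_mem_Ioo ⟨by linarith [hφ.1, pi_pos], h⟩).ne').le

lemma angularIntegral_continuousOn {p : ℝ} (hp : 2 < p) :
    ContinuousOn (angularIntegral p) (Icc 0 1) := by
  intro c hc
  refine intervalIntegral.continuousWithinAt_of_dominated_interval (bound := fun _ => 1) ?_ ?_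
    (by simp) ?_
  · refine Filter.Eventually.of_forall fun d => Measurable.aestronglyMeasurable ?_
    have := (continuous_powSlope (p := p) (by linarith)).measurable
    unfold ratioSq
    fun_prop
  · filter_upwards [self_mem_nhdsWithin] with d hd
    refine Filter.Eventually.of_forall fun φ _ => ?_
    have := one_le_powSlope hp (ratioSq_nonneg d φ) (ratioSq_le_one hd φ)
    rw [Real.norm_of_nonneg (by positivity)]
    exact inv_le_one_of_one_le₀ (Real.one_le_sqrt.2 this)
  · have hne : ∀ᵐ φ : ℝ, φ ≠ π / 2 := by simp [ae_iff]
    filter_upwards [hne] with φ hφ hφI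
    rw [uIoc_of_le (by positivity)] at hφI
    have hC : 0 < cos φ := cos_pos_of_mem_Ioo
      ⟨by linarith [hφI.1, pi_pos], lt_of_le_of_ne hφI.2 hφ⟩
    have h1 := one_le_powSlope hp (ratioSq_nonneg c φ) (ratioSq_le_one hc φ)
    have hr : ContinuousAt (fun d => ratioSq d φ) c := by
      unfold ratioSq
      exact ContinuousAt.div (by fun_prop) (by fun_prop) (by positivity)
    refine ContinuousAt.continuousWithinAt (ContinuousAt.inv₀ (ContinuousAt.sqrt ?_)
      (Real.sqrt_pos.2 (by linarith)).ne')
    exact (continuous_powSlope (by linarith)).continuousAt.comp' hr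

lemma angularIntegral_zero {p : ℝ} (hp : 0 < p) : angularIntegral p 0 = π / 2 := by
  simp [angularIntegral, ratioSq, powSlope_zero hp]

lemma angularIntegral_one (p : ℝ) : angularIntegral p 1 = π / 2 * (√(p / 2))⁻¹ := by
  have h : ∀ φ, ratioSq 1 φ = 1 := fun φ => by simp [ratioSq]
  simp only [angularIntegral, h, powSlope_one, intervalIntegral.integral_const, sub_zero,
    smul_eq_mul]

lemma angularIntegral_nonneg (p c : ℝ) : 0 ≤ angularIntegral p c :=
  intervalIntegral.integral_nonneg (by positivity) fun _ _ => by positivity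

lemma exists_angularIntegral_eq {p : ℝ} (hp : 9 / 2 < p) :
    ∃ c ∈ Ioo (0 : ℝ) 1, angularIntegral p c = π / 3 := by
  refine intermediate_value_Ioo' zero_le_one
    (angularIntegral_continuousOn (p := p) (by linarith)) ⟨?_, ?_⟩
  · rw [angularIntegral_one, ← div_eq_mul_inv]
    have : (3 / 2 : ℝ) < √(p / 2) := Real.lt_sqrt_of_sq_lt (by linarith)
    rw [div_lt_iff₀ (by linarith)]
    nlinarith [pi_pos]
  · rw [angularIntegral_zero (by linarith)]
    linarith [pi_pos]

lemma lintegral_inner_eq {p t : ℝ} (hp : 2 < p) (ht : 0 < t) (htV : t < (1 / 4 : ℝ) ^ (1 / p)) :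
    ∫⁻ w in Ioo t ((1 / 4 : ℝ) ^ (1 / p)), ENNReal.ofReal (t / √(w ^ 2 - t ^ 2)) *
        ENNReal.ofReal ((w * √(1 - 4 * w ^ p))⁻¹) =
      ENNReal.ofReal (angularIntegral p (t / (1 / 4 : ℝ) ^ (1 / p))) := by
  have hV4 := four_inv_rpow (p := p) (by linarith)
  set V : ℝ := (1 / 4 : ℝ) ^ (1 / p)
  have hV : 0 < V := ht.trans htV
  obtain ⟨c, hc⟩ : ∃ c, c = t / V := ⟨_, rfl⟩
  rw [← hc]
  have hc0 : 0 < c := hc ▸ by positivity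
  have hc1 : c < 1 := hc ▸ (div_lt_one hV).2 htV
  have hc2 : 0 < 1 - c ^ 2 := by nlinarith
  have hD := ratioSq_denom_pos hc0
  have hDs : ∀ φ, cos φ ^ 2 + c ^ 2 * sin φ ^ 2 = 1 - (1 - c ^ 2) * sin φ ^ 2 := fun φ => by
    linear_combination sin_sq_add_cos_sq φ
  have hmain := lintegral_Ioo_eq_of_strictMonoOn (a := 0) (b := π / 2)
    (f := fun φ => t / √(cos φ ^ 2 + c ^ 2 * sin φ ^ 2))
    (f' := fun φ => t * (1 - c ^ 2) * sin φ * cos φ /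
      ((cos φ ^ 2 + c ^ 2 * sin φ ^ 2) * √(cos φ ^ 2 + c ^ 2 * sin φ ^ 2))) (by positivity)
    (continuousOn_const.div (by fun_prop) fun φ _ => (Real.sqrt_pos.2 (hD φ)).ne') ?_ ?_
    (fun w => ENNReal.ofReal (t / √(w ^ 2 - t ^ 2)) * ENNReal.ofReal ((w * √(1 - 4 * w ^ p))⁻¹))
  · have h0 : t / √(cos 0 ^ 2 + c ^ 2 * sin 0 ^ 2) = t := by simp
    have h1 : t / √(cos (π / 2) ^ 2 + c ^ 2 * sin (π / 2) ^ 2) = V := by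
      simp only [cos_pi_div_two, sin_pi_div_two]
      rw [show (0 : ℝ) ^ 2 + c ^ 2 * 1 ^ 2 = c ^ 2 by ring, Real.sqrt_sq hc0.le, hc]
      field_simp
    simp only [h0, h1] at hmain
    rw [hmain, angularIntegral, intervalIntegral.integral_of_le (by positivity),
      integral_Ioc_eq_integral_Ioo,
      ofReal_integral_eq_lintegral_ofReal
        (((continuous_angularIntegrand hp ⟨hc0, hc1.le⟩).integrableOn_Icc).mono_set
          Ioo_subset_Icc_self)
        (Filter.Eventually.of_forall fun φ => by positivity)]
    refine setLIntegral_congr_fun measurableSet_Ioo fun φ hφ => ?_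
    have hC : 0 < cos φ := cos_pos_of_mem_Ioo ⟨by linarith [hφ.1, pi_pos], hφ.2⟩
    have hS : 0 < sin φ := sin_pos_of_pos_of_lt_pi hφ.1 (by linarith [hφ.2, pi_pos])
    have hX : 1 - ratioSq c φ =
        (1 - c ^ 2) * cos φ ^ 2 / (cos φ ^ 2 + c ^ 2 * sin φ ^ 2) := by
      rw [ratioSq, eq_div_iff (hD φ).ne', sub_mul, div_mul_cancel₀ _ (hD φ).ne']
      linear_combination c ^ 2 * sin_sq_add_cos_sq φ
    have hX1 : 0 < 1 - ratioSq c φ := by rw [hX]; have := hD φ; positivity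
    have hX0 := ratioSq_nonneg c φ
    have hXp : 0 < 1 - ratioSq c φ ^ (p / 2) :=
      sub_pos.2 (Real.rpow_lt_one hX0 (by linarith) (by linarith))
    have hw : 4 * (t / √(cos φ ^ 2 + c ^ 2 * sin φ ^ 2)) ^ p = ratioSq c φ ^ (p / 2) := by
      have h2 : ratioSq c φ = (t / √(cos φ ^ 2 + c ^ 2 * sin φ ^ 2) / V) ^ 2 := by
        rw [div_pow, div_pow, Real.sq_sqrt (hD φ).le, ratioSq, hc, div_pow]
        field_simp
      rw [h2, ← Real.rpow_natCast (t / √(cos φ ^ 2 + c ^ 2 * sin φ ^ 2) / V),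
        ← Real.rpow_mul (by positivity),
        Real.div_rpow (by positivity) hV.le, show ((2 : ℕ) : ℝ) * (p / 2) = p by push_cast; ring,
        hV4]
      ring
    have hs : √((t / √(cos φ ^ 2 + c ^ 2 * sin φ ^ 2)) ^ 2 - t ^ 2) =
        t * √(1 - c ^ 2) * sin φ / √(cos φ ^ 2 + c ^ 2 * sin φ ^ 2) := by
      have h3 : (t / √(cos φ ^ 2 + c ^ 2 * sin φ ^ 2)) ^ 2 - t ^ 2 =
          (t * √(1 - c ^ 2) * sin φ / √(cos φ ^ 2 + c ^ 2 * sin φ ^ 2)) ^ 2 := by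
        rw [div_pow, div_pow, Real.sq_sqrt (hD φ).le, mul_pow, mul_pow, Real.sq_sqrt hc2.le,
          eq_div_iff (hD φ).ne', sub_mul, div_mul_cancel₀ _ (hD φ).ne', hDs]
        ring
      rw [h3, Real.sqrt_sq (by positivity)]
    have hr : (√(powSlope p (ratioSq c φ)))⁻¹ =
        √(1 - c ^ 2) * cos φ / √(cos φ ^ 2 + c ^ 2 * sin φ ^ 2) /
          √(1 - ratioSq c φ ^ (p / 2)) := by
      rw [powSlope_of_ne (by linarith), Real.sqrt_div hXp.le, inv_div, hX,
        Real.sqrt_div' _ (hD φ).le, Real.sqrt_mul hc2.le, Real.sqrt_sq hC.le]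
    have hE := Real.sqrt_pos.2 (hD φ)
    have hE2 := Real.sq_sqrt (hD φ).le
    have hQ := Real.sqrt_pos.2 hXp
    have hc3 := Real.sqrt_pos.2 hc2
    have hc4 := Real.sq_sqrt hc2.le
    simp only [hs, hw]
    rw [hr]
    generalize √(1 - ratioSq c φ ^ (p / 2)) = Q at *
    generalize √(cos φ ^ 2 + c ^ 2 * sin φ ^ 2) = E at *
    rw [← hE2, ← ENNReal.ofReal_mul (by positivity), ← ENNReal.ofReal_mul (by positivity)]
    congr 1
    generalize √(1 - c ^ 2) = A at *
    rw [← hc4]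
    field_simp
  · intro x hx y hy hxy
    refine div_lt_div_of_pos_left ht (Real.sqrt_pos.2 (hD y)) (Real.sqrt_lt_sqrt (hD y).le ?_)
    rw [hDs, hDs]
    have h1 : 0 ≤ sin x := sin_nonneg_of_nonneg_of_le_pi hx.1 (by linarith [hx.2, pi_pos])
    have h2 : sin x < sin y := sin_lt_sin_of_lt_of_le_pi_div_two (by linarith [hx.1, pi_pos]) hy.2 hxy
    have h3 : sin x ^ 2 < sin y ^ 2 := by nlinarith
    nlinarith
  · intro φ _
    have h1 := (((hasDerivAt_cos φ).pow 2).add (((hasDerivAt_sin φ).pow 2).const_mul (c ^ 2))).sqrt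
      (hD φ).ne'
    have h2 := h1.fun_inv (Real.sqrt_pos.2 (hD φ)).ne' |>.const_mul t
    refine (h2.congr_deriv ?_).congr_of_eventuallyEq (Filter.Eventually.of_forall fun x => ?_)
    · have hE := Real.sqrt_pos.2 (hD φ)
      have hE2 := Real.sq_sqrt (hD φ).le
      simp only [Pi.add_apply, Pi.pow_apply]
      generalize √(cos φ ^ 2 + c ^ 2 * sin φ ^ 2) = E at *
      rw [← hE2]
      field_simp
      ring
    · exact div_eq_mul_inv _ _

lemma g_eq_integral_angularIntegral {p v : ℝ} (hp : 2 < p) (hv : 0 < v)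
    (hvV : v < (1 / 4 : ℝ) ^ (1 / p)) :
    g p v = 2 * ∫ t in v..(1 / 4 : ℝ) ^ (1 / p),
      angularIntegral p (t / (1 / 4 : ℝ) ^ (1 / p)) := by
  have hp0 : 0 < p := by linarith
  have hvp : 0 < v ^ p := Real.rpow_pos_of_pos hv p
  have hle : rMinus p v ≤ rPlus p v :=
    Real.rpow_le_rpow (sub_pos.2 (sqrt_quarter_sub_lt hvp)).le
      (by linarith [Real.sqrt_nonneg (1 / 4 - v ^ p)]) (by positivity)
  have hV : 0 < (1 / 4 : ℝ) ^ (1 / p) := by positivity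
  have hmaps : MapsTo (fun t => t / (1 / 4 : ℝ) ^ (1 / p)) (Ioo v ((1 / 4 : ℝ) ^ (1 / p)))
      (Icc 0 1) := fun t ht =>
    ⟨div_nonneg (hv.trans ht.1).le hV.le, (div_le_one hV).2 ht.2.le⟩
  rw [g, intervalIntegral.integral_of_le hle, intervalIntegral.integral_of_le hvV.le,
    integral_Ioc_eq_integral_Ioo, integral_Ioc_eq_integral_Ioo,
    integral_eq_lintegral_of_nonneg_ae (Filter.Eventually.of_forall fun r => Real.sqrt_nonneg _)
      (Measurable.aestronglyMeasurable (by fun_prop)),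
    integral_eq_lintegral_of_nonneg_ae
      (Filter.Eventually.of_forall fun t => angularIntegral_nonneg p _)
      (((angularIntegral_continuousOn hp).comp (by fun_prop) hmaps).aestronglyMeasurable
        measurableSet_Ioo),
    lintegral_integrand_eq hp0 hv hvV,
    lintegral_sqrt_mul_eq hv (by fun_prop)]
  congr 2
  exact setLIntegral_congr_fun measurableSet_Ioo fun t ht =>
    lintegral_inner_eq hp (hv.trans ht.1) ht.2

lemma deriv_g_eq {p v : ℝ} (hp : 2 < p) (hv : v ∈ Ioo (0 : ℝ) ((1 / 4 : ℝ) ^ (1 / p))) :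
    deriv (g p) v = -(2 * angularIntegral p (v / (1 / 4 : ℝ) ^ (1 / p))) := by
  have hV : 0 < (1 / 4 : ℝ) ^ (1 / p) := by positivity
  have hcont : ContinuousOn (fun t => angularIntegral p (t / (1 / 4 : ℝ) ^ (1 / p)))
      (Icc 0 ((1 / 4 : ℝ) ^ (1 / p))) :=
    (angularIntegral_continuousOn hp).comp (by fun_prop) fun t ht =>
      ⟨div_nonneg ht.1 hV.le, (div_le_one hV).2 ht.2⟩
  have h := intervalIntegral.integral_hasDerivAt_left
    ((hcont.mono (Icc_subset_Icc_left hv.1.le)).intervalIntegrable_of_Icc hv.2.le)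
    ((hcont.mono Ioo_subset_Icc_self).stronglyMeasurableAtFilter isOpen_Ioo v hv)
    (hcont.continuousAt (Icc_mem_nhds hv.1 hv.2))
  have h2 := (h.const_mul 2).congr_of_eventuallyEq (f₁ := g p) (by
    filter_upwards [isOpen_Ioo.mem_nhds hv] with u hu
    exact g_eq_integral_angularIntegral hp hu.1 hu.2)
  rw [h2.deriv]
  ring

/-- for `p > 2`, the derivative `g_p'` is injective on `(0, (1/4)^(1/p))`;
moreover for `p > 9/2` there exists `v ∈ (0, (1/4)^(1/p))` with `g_p'(v) = −2π/3`. -/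
theorem g_deriv_injective_and_hits (p : ℝ) :
    (2 < p → Set.InjOn (deriv (g p)) (Set.Ioo (0 : ℝ) ((1 / 4 : ℝ) ^ (1 / p)))) ∧
    (9 / 2 < p → ∃ v ∈ Set.Ioo (0 : ℝ) ((1 / 4 : ℝ) ^ (1 / p)),
      deriv (g p) v = -(2 * π / 3)) := by
  have hV : 0 < (1 / 4 : ℝ) ^ (1 / p) := by positivity
  refine ⟨fun hp v hv w hw h => ?_, fun hp => ?_⟩
  · rw [deriv_g_eq hp hv, deriv_g_eq hp hw, neg_inj] at h
    have := (angularIntegral_strictAntiOn hp).injOn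
      ⟨div_pos hv.1 hV, (div_lt_one hV).2 hv.2⟩ ⟨div_pos hw.1 hV, (div_lt_one hV).2 hw.2⟩
      (mul_left_cancel₀ two_ne_zero h)
    exact (div_left_inj' hV.ne').1 this
  · obtain ⟨c, hc, h⟩ := exists_angularIntegral_eq hp
    have hm : c * (1 / 4 : ℝ) ^ (1 / p) ∈ Ioo (0 : ℝ) ((1 / 4 : ℝ) ^ (1 / p)) :=
      ⟨mul_pos hc.1 hV, mul_lt_of_lt_one_left hV hc.2⟩
    refine ⟨_, hm, ?_⟩
    rw [deriv_g_eq (by linarith) hm, mul_div_cancel_right₀ _ hV.ne', h]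
    ring
end

section
/- For fixed v > 0, the value g_p(v) is strictly increasing in the parameter p: if 1 ≤ p₁ < p₂ and 0 < v < (1/4)^(1/p₁), then v < (1/4)^(1/p₂) and g_{p₁}(v) < g_{p₂}(v). -/
open Real

lemma rpow_lt_quarter_s9 {p v : ℝ} (hp : 1 ≤ p) (hv0 : 0 < v) (hv : v < (1 / 4 : ℝ) ^ (1 / p)) :
    v ^ p < 1 / 4 := by
  have h := rpow_lt_rpow hv0.le hv (by linarith : 0 < p)
  rwa [← rpow_mul (by norm_num), one_div_mul_cancel (by linarith), rpow_one] at h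

lemma sqrt_lt_half {p v : ℝ} (hv0 : 0 < v) : √(1 / 4 - v ^ p) < 1 / 2 := by
  rw [Real.sqrt_lt' (by norm_num)]
  have := rpow_pos_of_pos hv0 p
  norm_num
  linarith

lemma rMinus_pos {p v : ℝ} (hv0 : 0 < v) : 0 < rMinus p v :=
  rpow_pos_of_pos (by linarith [sqrt_lt_half (p := p) hv0]) _

lemma rPlus_lt_one {p v : ℝ} (hp : 1 ≤ p) (hv0 : 0 < v) : rPlus p v < 1 :=
  rpow_lt_one (by positivity) (by linarith [sqrt_lt_half (p := p) hv0]) (by positivity)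

lemma rMinus_lt_rPlus {p v : ℝ} (hp : 1 ≤ p) (hv0 : 0 < v) (hv : v < (1 / 4 : ℝ) ^ (1 / p)) :
    rMinus p v < rPlus p v := by
  have h := Real.sqrt_pos.2 (sub_pos.2 (rpow_lt_quarter_s9 hp hv0 hv))
  exact rpow_lt_rpow (by linarith [sqrt_lt_half (p := p) hv0]) (by linarith) (by positivity)

lemma rMinus_rpow_mul {p v : ℝ} (hp : 1 ≤ p) (hv0 : 0 < v) (hv : v < (1 / 4 : ℝ) ^ (1 / p)) :
    rMinus p v ^ p * (1 - rMinus p v ^ p) = v ^ p := by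
  have hs := Real.sq_sqrt (sub_pos.2 (rpow_lt_quarter_s9 hp hv0 hv)).le
  rw [rMinus, ← rpow_mul (by linarith [sqrt_lt_half (p := p) hv0]),
    one_div_mul_cancel (by linarith), rpow_one]
  nlinarith

lemma rPlus_rpow_mul {p v : ℝ} (hp : 1 ≤ p) (hv0 : 0 < v) (hv : v < (1 / 4 : ℝ) ^ (1 / p)) :
    rPlus p v ^ p * (1 - rPlus p v ^ p) = v ^ p := by
  have hs := Real.sq_sqrt (sub_pos.2 (rpow_lt_quarter_s9 hp hv0 hv)).le
  rw [rPlus, ← rpow_mul (by positivity), one_div_mul_cancel (by linarith), rpow_one]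
  nlinarith

/-- `[r₋(v), r₊(v)]` contains every `r` with `v^p ≤ r^p (1 - r^p)`. -/
lemma mem_Icc_of_rpow_le {p v r : ℝ} (hp : 1 ≤ p) (hv0 : 0 < v) (hr : 0 < r)
    (h : v ^ p ≤ r ^ p * (1 - r ^ p)) : r ∈ Set.Icc (rMinus p v) (rPlus p v) := by
  have habs : |r ^ p - 1 / 2| ≤ √(1 / 4 - v ^ p) := Real.abs_le_sqrt (by nlinarith)
  obtain ⟨h1, h2⟩ := abs_le.1 habs
  have hrp : (r ^ p) ^ (1 / p) = r := by
    rw [← rpow_mul hr.le, mul_one_div_cancel (by linarith), rpow_one]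
  constructor
  · rw [← hrp]
    exact rpow_le_rpow (by linarith [sqrt_lt_half (p := p) hv0]) (by linarith) (by positivity)
  · rw [← hrp]
    exact rpow_le_rpow (by positivity) (by linarith) (by positivity)

lemma one_sub_rpow_rpow_lt {p₁ p₂ r c : ℝ} (hp₁ : 1 ≤ p₁) (hp : p₁ < p₂) (hc : 0 < c)
    (hr0 : 0 < r) (hr1 : r < 1) : (1 - r ^ p₁) ^ (c / p₁) < (1 - r ^ p₂) ^ (c / p₂) := by
  have h1 : r ^ p₁ < 1 := rpow_lt_one hr0.le hr1 (by linarith)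
  have h2 : r ^ p₂ < r ^ p₁ := rpow_lt_rpow_of_exponent_gt hr0 hr1 hp
  have h3 : 0 < r ^ p₂ := rpow_pos_of_pos hr0 _
  calc (1 - r ^ p₁) ^ (c / p₁) < (1 - r ^ p₂) ^ (c / p₁) :=
        rpow_lt_rpow (by linarith) (by linarith) (by positivity)
    _ ≤ (1 - r ^ p₂) ^ (c / p₂) :=
        rpow_le_rpow_of_exponent_ge (by linarith) (by linarith)
          (div_le_div_of_nonneg_left hc.le (by linarith) hp.le)

lemma rpow_le_of_exponent_lt {p₁ p₂ v r : ℝ} (hp₁ : 1 ≤ p₁) (hp : p₁ < p₂) (hv0 : 0 < v)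
    (hr0 : 0 < r) (hr1 : r < 1) (h : r ^ p₁ * (1 - r ^ p₁) = v ^ p₁) :
    v ^ p₂ ≤ r ^ p₂ * (1 - r ^ p₂) := by
  have h1 : r ^ p₁ < 1 := rpow_lt_one hr0.le hr1 (by linarith)
  have h2 : r ^ p₂ < 1 := rpow_lt_one hr0.le hr1 (by linarith)
  have hp₁0 : p₁ ≠ 0 := by linarith
  have hp₂0 : p₂ ≠ 0 := by linarith
  have hveq : v = r * (1 - r ^ p₁) ^ (1 / p₁) := by
    have := congrArg (· ^ (1 / p₁)) h
    beta_reduce at this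
    rw [mul_rpow (by positivity) (by linarith), ← rpow_mul hr0.le, ← rpow_mul hv0.le,
      mul_one_div_cancel hp₁0, rpow_one, rpow_one] at this
    exact this.symm
  have hle : v ≤ r * (1 - r ^ p₂) ^ (1 / p₂) := by
    rw [hveq]
    exact mul_le_mul_of_nonneg_left
      (one_sub_rpow_rpow_lt hp₁ hp one_pos hr0 hr1).le hr0.le
  calc v ^ p₂ ≤ (r * (1 - r ^ p₂) ^ (1 / p₂)) ^ p₂ := rpow_le_rpow hv0.le hle (by linarith)
    _ = r ^ p₂ * (1 - r ^ p₂) := by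
      rw [mul_rpow hr0.le (rpow_nonneg (by linarith) _), ← rpow_mul (by linarith),
        one_div_mul_cancel hp₂0, rpow_one]

lemma continuousOn_integrand {p v : ℝ} (hp : 1 ≤ p) :
    ContinuousOn (fun r : ℝ => √((1 - r ^ p) ^ (2 / p) - v ^ 2 / r ^ 2)) (Set.Ioi 0) := by
  have h1 : ContinuousOn (fun r : ℝ => r ^ p) (Set.Ioi 0) :=
    continuousOn_id.rpow_const fun _ _ => Or.inr (by linarith)
  refine (ContinuousOn.sub ?_ ?_).sqrt
  · exact (continuousOn_const.sub h1).rpow_const fun _ _ => Or.inr (by positivity)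
  · exact continuousOn_const.div (continuousOn_id.pow 2) fun r hr => pow_ne_zero 2 (ne_of_gt hr)

lemma sq_div_sq_eq {p v r : ℝ} (hp : 1 ≤ p) (hv0 : 0 < v) (hr0 : 0 < r) (hr1 : r < 1)
    (h : r ^ p * (1 - r ^ p) = v ^ p) : (1 - r ^ p) ^ (2 / p) = v ^ 2 / r ^ 2 := by
  have h1 : r ^ p < 1 := rpow_lt_one hr0.le hr1 (by linarith)
  have hpp : p * (2 / p) = (2 : ℕ) := by
    push_cast
    exact mul_div_cancel₀ 2 (by linarith)
  have := congrArg (· ^ (2 / p)) h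
  beta_reduce at this
  rw [mul_rpow (by positivity) (by linarith), ← rpow_mul hr0.le, ← rpow_mul hv0.le, hpp,
    rpow_natCast, rpow_natCast] at this
  rw [eq_div_iff (by positivity), mul_comm, this]

/-- for fixed `v > 0`, `g_p(v)` is strictly increasing in `p`:
if `1 ≤ p₁ < p₂` and `0 < v < (1/4)^(1/p₁)`, then `v < (1/4)^(1/p₂)` and
`g_{p₁}(v) < g_{p₂}(v)`. -/
theorem g_strictMono_in_p (p₁ p₂ v : ℝ) (hp₁ : 1 ≤ p₁) (hp : p₁ < p₂)
    (hv0 : 0 < v) (hv : v < (1 / 4 : ℝ) ^ (1 / p₁)) :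
    v < (1 / 4 : ℝ) ^ (1 / p₂) ∧ g p₁ v < g p₂ v := by
  have hp₂ : 1 ≤ p₂ := hp₁.trans hp.le
  refine ⟨hv.trans_le (rpow_le_rpow_of_exponent_ge (by norm_num) (by norm_num)
    (one_div_le_one_div_of_le (by linarith) hp.le)), ?_⟩
  have ha₁ : 0 < rMinus p₁ v := rMinus_pos hv0
  have ha₂ : 0 < rMinus p₂ v := rMinus_pos hv0
  have hb₁ : rPlus p₁ v < 1 := rPlus_lt_one hp₁ hv0
  have hab := rMinus_lt_rPlus hp₁ hv0 hv
  have hamem := mem_Icc_of_rpow_le hp₂ hv0 ha₁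
    (rpow_le_of_exponent_lt hp₁ hp hv0 ha₁ (hab.trans hb₁) (rMinus_rpow_mul hp₁ hv0 hv))
  have hbmem := mem_Icc_of_rpow_le hp₂ hv0 (ha₁.trans hab)
    (rpow_le_of_exponent_lt hp₁ hp hv0 (ha₁.trans hab) hb₁ (rPlus_rpow_mul hp₁ hv0 hv))
  have hsub : Set.Icc (rMinus p₁ v) (rPlus p₁ v) ⊆ Set.Ioi 0 := fun r hr => ha₁.trans_le hr.1
  refine mul_lt_mul_of_pos_left (lt_of_lt_of_le
    (intervalIntegral.integral_lt_integral_of_continuousOn_of_le_of_exists_lt hab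
      ((continuousOn_integrand hp₁).mono hsub) ((continuousOn_integrand hp₂).mono hsub)
      (fun r hr => ?_) ⟨rMinus p₁ v, Set.left_mem_Icc.2 hab.le, ?_⟩)
    (intervalIntegral.integral_mono_interval hamem.1 hab.le hbmem.2
      (Filter.Eventually.of_forall fun r => Real.sqrt_nonneg _) ?_)) two_pos
  · exact Real.sqrt_le_sqrt (sub_le_sub_right
      (one_sub_rpow_rpow_lt hp₁ hp two_pos (ha₁.trans hr.1) (hr.2.trans_lt hb₁)).le _)
  · refine Real.sqrt_lt_sqrt ?_ (sub_lt_sub_right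
      (one_sub_rpow_rpow_lt hp₁ hp two_pos ha₁ (hab.trans hb₁)) _)
    exact (sub_eq_zero.2 (sq_div_sq_eq hp₁ hv0 ha₁ (hab.trans hb₁)
      (rMinus_rpow_mul hp₁ hv0 hv))).ge
  · refine ContinuousOn.intervalIntegrable_of_Icc (hamem.1.trans (hab.le.trans hbmem.2))
      ((continuousOn_integrand hp₂).mono fun r hr => ha₂.trans_le hr.1)
end

section
/- Let p ≥ 1, let h > 0, and let v ∈ ℝ with |v| < (h/2)^(2/p). Then the joint level set {(x,y) ∈ ℝ²×ℝ² : ‖x‖^p + ‖y‖^p = h and y₁x₂ − y₂x₁ = v} is a compact and connected subset of ℝ⁴. -/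
open Real

/-- The joint level set of `‖x‖ ^ p + ‖y‖ ^ p` and of the angular momentum. -/
def jointLevelSet (p h v : ℝ) : Set (EuclideanSpace ℝ (Fin 2) × EuclideanSpace ℝ (Fin 2)) :=
  {z | ‖z.1‖ ^ p + ‖z.2‖ ^ p = h ∧ z.2 0 * z.1 1 - z.2 1 * z.1 0 = v}

/-- The pair `(x, y)` with `‖x‖ = r`, `‖y‖ = s`, `⟪x, y⟫ = c` and angular momentum `v` whose matrix
is the product of the rotation by `-θ` and a positive semidefinite symmetric matrix. -/
noncomputable def polarPair (v r s c θ : ℝ) :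
    EuclideanSpace ℝ (Fin 2) × EuclideanSpace ℝ (Fin 2) :=
  (!₂[(cos θ * (r ^ 2 - v) + sin θ * c) / √(r ^ 2 + s ^ 2 - 2 * v),
      (cos θ * c - sin θ * (r ^ 2 - v)) / √(r ^ 2 + s ^ 2 - 2 * v)],
   !₂[(cos θ * c + sin θ * (s ^ 2 - v)) / √(r ^ 2 + s ^ 2 - 2 * v),
      (cos θ * (s ^ 2 - v) - sin θ * c) / √(r ^ 2 + s ^ 2 - 2 * v)])

section polarPair

variable {v r s c : ℝ}

lemma norm_polarPair_fst (hr : 0 ≤ r) (hτ : 0 < r ^ 2 + s ^ 2 - 2 * v)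
    (hc : c ^ 2 + v ^ 2 = r ^ 2 * s ^ 2) (θ : ℝ) : ‖(polarPair v r s c θ).1‖ = r := by
  rw [← sq_eq_sq₀ (norm_nonneg _) hr, EuclideanSpace.norm_sq_eq]
  simp only [polarPair, Fin.sum_univ_two, Real.norm_eq_abs, sq_abs, PiLp.toLp_apply,
    Matrix.cons_val_zero, Matrix.cons_val_one, div_pow, Real.sq_sqrt hτ.le]
  rw [← add_div, div_eq_iff hτ.ne']
  linear_combination (c ^ 2 + (r ^ 2 - v) ^ 2) * sin_sq_add_cos_sq θ + hc

lemma norm_polarPair_snd (hs : 0 ≤ s) (hτ : 0 < r ^ 2 + s ^ 2 - 2 * v)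
    (hc : c ^ 2 + v ^ 2 = r ^ 2 * s ^ 2) (θ : ℝ) : ‖(polarPair v r s c θ).2‖ = s := by
  rw [← sq_eq_sq₀ (norm_nonneg _) hs, EuclideanSpace.norm_sq_eq]
  simp only [polarPair, Fin.sum_univ_two, Real.norm_eq_abs, sq_abs, PiLp.toLp_apply,
    Matrix.cons_val_zero, Matrix.cons_val_one, div_pow, Real.sq_sqrt hτ.le]
  rw [← add_div, div_eq_iff hτ.ne']
  linear_combination (c ^ 2 + (s ^ 2 - v) ^ 2) * sin_sq_add_cos_sq θ + hc

lemma angularMomentum_polarPair (hτ : 0 < r ^ 2 + s ^ 2 - 2 * v)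
    (hc : c ^ 2 + v ^ 2 = r ^ 2 * s ^ 2) (θ : ℝ) :
    (polarPair v r s c θ).2 0 * (polarPair v r s c θ).1 1 -
      (polarPair v r s c θ).2 1 * (polarPair v r s c θ).1 0 = v := by
  simp only [polarPair, PiLp.toLp_apply, Matrix.cons_val_zero, Matrix.cons_val_one,
    div_mul_div_comm, Real.mul_self_sqrt hτ.le]
  rw [← sub_div, div_eq_iff hτ.ne']
  linear_combination (c ^ 2 - (r ^ 2 - v) * (s ^ 2 - v)) * sin_sq_add_cos_sq θ + hc

lemma continuousOn_polarPair {X : Type*} [TopologicalSpace X] {r s c θ : X → ℝ} {K : Set X}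
    (hr : Continuous r) (hs : Continuous s) (hc : Continuous c) (hθ : Continuous θ)
    (hτ : ∀ q ∈ K, 0 < r q ^ 2 + s q ^ 2 - 2 * v) :
    ContinuousOn (fun q => polarPair v (r q) (s q) (c q) (θ q)) K := by
  have hτc : Continuous fun q => √(r q ^ 2 + s q ^ 2 - 2 * v) := by fun_prop
  have hdiv {f : X → ℝ} (hf : Continuous f) :
      ContinuousOn (fun q => f q / √(r q ^ 2 + s q ^ 2 - 2 * v)) K :=
    hf.continuousOn.div hτc.continuousOn fun q hq => (Real.sqrt_pos.2 (hτ q hq)).ne'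
  have hpair {f g : X → ℝ} (hf : ContinuousOn f K) (hg : ContinuousOn g K) :
      ContinuousOn (fun q => !₂[f q, g q]) K :=
    (PiLp.continuous_toLp 2 _).comp_continuousOn
      (continuousOn_pi.2 (Fin.forall_fin_two.2 ⟨hf, hg⟩))
  exact (hpair (hdiv (by fun_prop)) (hdiv (by fun_prop))).prodMk
    (hpair (hdiv (by fun_prop)) (hdiv (by fun_prop)))

end polarPair

lemma exists_eq_polarPair {v : ℝ} {z : EuclideanSpace ℝ (Fin 2) × EuclideanSpace ℝ (Fin 2)}
    (hτ : 0 < ‖z.1‖ ^ 2 + ‖z.2‖ ^ 2 - 2 * v) (hz : z.2 0 * z.1 1 - z.2 1 * z.1 0 = v) :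
    ∃ c, c ^ 2 + v ^ 2 = ‖z.1‖ ^ 2 * ‖z.2‖ ^ 2 ∧
      ∃ θ ∈ Set.Icc (-π) π, z = polarPair v ‖z.1‖ ‖z.2‖ c θ := by
  obtain ⟨x, y⟩ := z
  have hx : ‖x‖ ^ 2 = x 0 ^ 2 + x 1 ^ 2 := by simp [EuclideanSpace.norm_sq_eq]
  have hy : ‖y‖ ^ 2 = y 0 ^ 2 + y 1 ^ 2 := by simp [EuclideanSpace.norm_sq_eq]
  simp only at hτ hz ⊢
  refine ⟨x 0 * y 0 + x 1 * y 1, by rw [hx, hy, ← hz]; ring, ?_⟩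
  set w : ℂ := ⟨x 0 + y 1, y 0 - x 1⟩ with hw
  have hwn : ‖w‖ = √(‖x‖ ^ 2 + ‖y‖ ^ 2 - 2 * v) := by
    rw [Complex.norm_eq_sqrt_sq_add_sq, hx, hy, ← hz]
    congr 1
    simp only [hw]
    ring
  have hcos : x 0 + y 1 = √(‖x‖ ^ 2 + ‖y‖ ^ 2 - 2 * v) * cos w.arg := by
    rw [← hwn, Complex.norm_mul_cos_arg]
  have hsin : y 0 - x 1 = √(‖x‖ ^ 2 + ‖y‖ ^ 2 - 2 * v) * sin w.arg := by
    rw [← hwn, Complex.norm_mul_sin_arg]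
  have hpos : 0 < √(‖x‖ ^ 2 + ‖y‖ ^ 2 - 2 * v) := Real.sqrt_pos.2 hτ
  have hsq := sin_sq_add_cos_sq w.arg
  refine ⟨w.arg, ⟨(Complex.neg_pi_lt_arg w).le, Complex.arg_le_pi w⟩, ?_⟩
  unfold polarPair
  generalize √(‖x‖ ^ 2 + ‖y‖ ^ 2 - 2 * v) = τ at *
  generalize cos w.arg = a at *
  generalize sin w.arg = b at *
  have hxa : ‖x‖ ^ 2 - v = τ * a * x 0 - τ * b * x 1 := by rw [← hcos, ← hsin, hx, ← hz]; ring
  have hya : ‖y‖ ^ 2 - v = τ * a * y 1 + τ * b * y 0 := by rw [← hcos, ← hsin, hy, ← hz]; ring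
  have hcx : x 0 * y 0 + x 1 * y 1 = τ * b * x 0 + τ * a * x 1 := by rw [← hcos, ← hsin]; ring
  have hcy : x 0 * y 0 + x 1 * y 1 = τ * a * y 0 - τ * b * y 1 := by rw [← hcos, ← hsin]; ring
  refine Prod.ext ?_ ?_ <;> ext i <;> fin_cases i <;> simp <;> rw [eq_div_iff hpos.ne']
  · rw [hxa, hcx]; linear_combination -(x 0 * τ) * hsq
  · rw [hxa, hcx]; linear_combination -(x 1 * τ) * hsq
  · rw [hya, hcy]; linear_combination -(y 0 * τ) * hsq
  · rw [hya, hcy]; linear_combination -(y 1 * τ) * hsq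

/-- The pairs with `‖x‖ ^ p = t`, `‖y‖ ^ p = h - t` and angular momentum `v`, where `ε = ±1` is the
sign of `⟪x, y⟫`. -/
noncomputable def levelPair (p h v ε : ℝ) (q : ℝ × ℝ) :
    EuclideanSpace ℝ (Fin 2) × EuclideanSpace ℝ (Fin 2) :=
  polarPair v (q.1 ^ p⁻¹) ((h - q.1) ^ p⁻¹)
    (ε * √((q.1 ^ p⁻¹) ^ 2 * ((h - q.1) ^ p⁻¹) ^ 2 - v ^ 2)) q.2

section levelPair

variable {p h v : ℝ}

lemma trace_pos (hh : 0 < h) (hv : v ≤ 0) {t : ℝ} (ht : t ∈ Set.Icc 0 h) :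
    0 < (t ^ p⁻¹) ^ 2 + ((h - t) ^ p⁻¹) ^ 2 - 2 * v := by
  rcases ht.1.eq_or_lt with rfl | h0
  · have := rpow_pos_of_pos hh p⁻¹
    rw [sub_zero]
    nlinarith [sq_nonneg ((0 : ℝ) ^ p⁻¹), pow_pos this 2]
  · nlinarith [sq_nonneg ((h - t) ^ p⁻¹), pow_pos (rpow_pos_of_pos h0 p⁻¹) 2]

lemma continuousOn_levelPair (hp : 0 < p) (hh : 0 < h) (hv : v ≤ 0) (ε : ℝ) :
    ContinuousOn (levelPair p h v ε) (Set.Icc 0 h ×ˢ Set.univ) := by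
  have h1 : Continuous fun q : ℝ × ℝ => q.1 ^ p⁻¹ :=
    continuous_fst.rpow_const fun _ => Or.inr (inv_nonneg.2 hp.le)
  have h2 : Continuous fun q : ℝ × ℝ => (h - q.1) ^ p⁻¹ :=
    (continuous_const.sub continuous_fst).rpow_const fun _ => Or.inr (inv_nonneg.2 hp.le)
  exact continuousOn_polarPair h1 h2
    (continuous_const.mul (((h1.pow 2).mul (h2.pow 2)).sub continuous_const).sqrt)
    continuous_snd fun q hq => trace_pos hh hv hq.1

lemma sq_le_iff_mem_Icc (hp : 0 < p) (hvh : |v| ^ p ≤ (h / 2) ^ 2) {t : ℝ}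
    (ht : t ∈ Set.Icc 0 h) :
    v ^ 2 ≤ (t ^ p⁻¹) ^ 2 * ((h - t) ^ p⁻¹) ^ 2 ↔
      t ∈ Set.Icc (h / 2 - √((h / 2) ^ 2 - |v| ^ p)) (h / 2 + √((h / 2) ^ 2 - |v| ^ p)) := by
  have h2 : 0 ≤ h - t := sub_nonneg.2 ht.2
  rw [← mul_pow, ← mul_rpow ht.1 h2, sq_le_sq, abs_of_nonneg (rpow_nonneg (mul_nonneg ht.1 h2) _),
    le_rpow_inv_iff_of_pos (abs_nonneg v) (mul_nonneg ht.1 h2) hp, ← Real.closedBall_eq_Icc,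
    mem_closedBall_iff_norm, Real.norm_eq_abs, ← Real.sqrt_sq_eq_abs (t - h / 2),
    Real.sqrt_le_sqrt_iff (sub_nonneg.2 hvh)]
  constructor <;> intro H <;> linarith

lemma Icc_subset_Icc_zero (hh : 0 < h) :
    Set.Icc (h / 2 - √((h / 2) ^ 2 - |v| ^ p)) (h / 2 + √((h / 2) ^ 2 - |v| ^ p)) ⊆
      Set.Icc 0 h := by
  have : √((h / 2) ^ 2 - |v| ^ p) ≤ h / 2 := by
    rw [Real.sqrt_le_left (by positivity)]
    linarith [rpow_nonneg (abs_nonneg v) p]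
  exact Set.Icc_subset_Icc (by linarith) (by linarith)

lemma jointLevelSet_eq_union (hp : 0 < p) (hh : 0 < h) (hv : v ≤ 0)
    (hvh : |v| ^ p ≤ (h / 2) ^ 2) {K : Set (ℝ × ℝ)}
    (hK : K = Set.Icc (h / 2 - √((h / 2) ^ 2 - |v| ^ p)) (h / 2 + √((h / 2) ^ 2 - |v| ^ p)) ×ˢ
      Set.Icc (-π) π) :
    jointLevelSet p h v = levelPair p h v 1 '' K ∪ levelPair p h v (-1) '' K := by
  subst hK
  apply Set.Subset.antisymm
  · rintro z ⟨hz, hm⟩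
    set t := ‖z.1‖ ^ p with ht
    have ht0 : t ∈ Set.Icc 0 h :=
      ⟨by positivity, by linarith [rpow_nonneg (norm_nonneg z.2) p]⟩
    have h1 : ‖z.1‖ = t ^ p⁻¹ := (rpow_rpow_inv (norm_nonneg _) hp.ne').symm
    have h2 : ‖z.2‖ = (h - t) ^ p⁻¹ := by
      rw [← hz, add_sub_cancel_left, rpow_rpow_inv (norm_nonneg _) hp.ne']
    have hτ := trace_pos (p := p) hh hv ht0
    rw [← h1, ← h2] at hτ
    obtain ⟨c, hc, θ, hθ, hzc⟩ := exists_eq_polarPair hτ hm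
    rw [h1, h2] at hc hzc
    have hc' : |c| = √((t ^ p⁻¹) ^ 2 * ((h - t) ^ p⁻¹) ^ 2 - v ^ 2) := by
      rw [← hc, add_sub_cancel_right, Real.sqrt_sq_eq_abs]
    have hmem : (t, θ) ∈ Set.Icc (h / 2 - √((h / 2) ^ 2 - |v| ^ p))
        (h / 2 + √((h / 2) ^ 2 - |v| ^ p)) ×ˢ Set.Icc (-π) π :=
      ⟨(sq_le_iff_mem_Icc hp hvh ht0).1 (by nlinarith [sq_nonneg c]), hθ⟩
    rcases abs_choice c with h' | h'
    · refine Or.inl ⟨(t, θ), hmem, ?_⟩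
      rw [levelPair, ← hc', h', one_mul, ← hzc]
    · refine Or.inr ⟨(t, θ), hmem, ?_⟩
      rw [levelPair, ← hc', h', neg_one_mul, neg_neg, ← hzc]
  · have key : ∀ ε : ℝ, ε ^ 2 = 1 → levelPair p h v ε '' (Set.Icc
        (h / 2 - √((h / 2) ^ 2 - |v| ^ p)) (h / 2 + √((h / 2) ^ 2 - |v| ^ p)) ×ˢ
        Set.Icc (-π) π) ⊆ jointLevelSet p h v := by
      rintro ε hε _ ⟨⟨t, θ⟩, ⟨ht, -⟩, rfl⟩
      have ht0 := Icc_subset_Icc_zero hh ht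
      have hτ := trace_pos (p := p) hh hv ht0
      have hc := (sq_le_iff_mem_Icc hp hvh ht0).2 ht
      have hc' : (ε * √((t ^ p⁻¹) ^ 2 * ((h - t) ^ p⁻¹) ^ 2 - v ^ 2)) ^ 2 + v ^ 2 =
          (t ^ p⁻¹) ^ 2 * ((h - t) ^ p⁻¹) ^ 2 := by
        rw [mul_pow, hε, Real.sq_sqrt (sub_nonneg.2 hc)]
        ring
      have h2 : 0 ≤ h - t := sub_nonneg.2 ht0.2
      refine ⟨?_, angularMomentum_polarPair hτ hc' θ⟩
      simp only [levelPair]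
      rw [norm_polarPair_fst (rpow_nonneg ht0.1 _) hτ hc',
        norm_polarPair_snd (rpow_nonneg h2 _) hτ hc', rpow_inv_rpow ht0.1 hp.ne',
        rpow_inv_rpow h2 hp.ne', add_sub_cancel]
    exact Set.union_subset (key 1 (by norm_num)) (key (-1) (by norm_num))

lemma isCompact_and_isConnected_jointLevelSet (hp : 0 < p) (hh : 0 < h) (hv : v ≤ 0)
    (hvh : |v| ^ p ≤ (h / 2) ^ 2) :
    IsCompact (jointLevelSet p h v) ∧ IsConnected (jointLevelSet p h v) := by
  rw [jointLevelSet_eq_union hp hh hv hvh rfl]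
  set δ := √((h / 2) ^ 2 - |v| ^ p) with hδ
  have hδ0 : 0 ≤ δ := Real.sqrt_nonneg _
  have hcont (ε : ℝ) : ContinuousOn (levelPair p h v ε)
      (Set.Icc (h / 2 - δ) (h / 2 + δ) ×ˢ Set.Icc (-π) π) :=
    (continuousOn_levelPair hp hh hv ε).mono
      (Set.prod_mono (Icc_subset_Icc_zero hh) (Set.subset_univ _))
  have hle : h / 2 - δ ≤ h / 2 + δ := by linarith
  have hπ : -π ≤ π := by linarith [pi_pos]
  have hconn : IsConnected (Set.Icc (h / 2 - δ) (h / 2 + δ) ×ˢ Set.Icc (-π) π) :=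
    (isConnected_Icc hle).prod (isConnected_Icc hπ)
  have hcomp : IsCompact (Set.Icc (h / 2 - δ) (h / 2 + δ) ×ˢ Set.Icc (-π) π) :=
    isCompact_Icc.prod isCompact_Icc
  refine ⟨(hcomp.image_of_continuousOn (hcont _)).union (hcomp.image_of_continuousOn (hcont _)),
    IsConnected.union ?_ (hconn.image _ (hcont _)) (hconn.image _ (hcont _))⟩
  have hq : (h / 2 - δ, π) ∈ Set.Icc (h / 2 - δ) (h / 2 + δ) ×ˢ Set.Icc (-π) π :=
    ⟨⟨le_rfl, hle⟩, hπ, le_rfl⟩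
  refine ⟨levelPair p h v 1 (h / 2 - δ, π), ⟨_, hq, rfl⟩, ⟨_, hq, ?_⟩⟩
  have ht := Icc_subset_Icc_zero (v := v) (p := p) hh hq.1
  have hprod : (h / 2 - δ) * (h - (h / 2 - δ)) = |v| ^ p := by
    linear_combination -Real.sq_sqrt (sub_nonneg.2 hvh)
  have hzero : ((h / 2 - δ) ^ p⁻¹) ^ 2 * ((h - (h / 2 - δ)) ^ p⁻¹) ^ 2 - v ^ 2 = 0 := by
    rw [← mul_pow, ← mul_rpow ht.1 (sub_nonneg.2 ht.2), hprod,
      rpow_rpow_inv (abs_nonneg v) hp.ne', sq_abs, sub_self]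
  simp only [levelPair, hzero, Real.sqrt_zero, mul_zero]

lemma swap_image_jointLevelSet (p h v : ℝ) :
    Prod.swap '' jointLevelSet p h v = jointLevelSet p h (-v) := by
  rw [Set.image_swap_eq_preimage_swap]
  ext z
  simp only [jointLevelSet, Set.mem_preimage, Set.mem_ofPred_eq, Prod.fst_swap, Prod.snd_swap]
  rw [add_comm, ← neg_inj (b := v)]
  ring_nf

end levelPair

/-- for `p ≥ 1`, `h > 0` and `|v| < (h/2)^(2/p)`, the joint level set
`{(x,y) : ‖x‖^p + ‖y‖^p = h, y₁x₂ − y₂x₁ = v}` is compact and connected. -/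
theorem level_set_compact_connected (p h v : ℝ) (hp : 1 ≤ p) (hh : 0 < h)
    (hv : |v| < (h / 2) ^ (2 / p)) :
    IsCompact {z : EuclideanSpace ℝ (Fin 2) × EuclideanSpace ℝ (Fin 2) |
        ‖z.1‖ ^ p + ‖z.2‖ ^ p = h ∧ z.2 0 * z.1 1 - z.2 1 * z.1 0 = v} ∧
    IsConnected {z : EuclideanSpace ℝ (Fin 2) × EuclideanSpace ℝ (Fin 2) |
        ‖z.1‖ ^ p + ‖z.2‖ ^ p = h ∧ z.2 0 * z.1 1 - z.2 1 * z.1 0 = v} := by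
  change IsCompact (jointLevelSet p h v) ∧ IsConnected (jointLevelSet p h v)
  have hp0 : 0 < p := by linarith
  have hvh : |v| ^ p ≤ (h / 2) ^ 2 := by
    rw [div_eq_mul_inv 2 p, rpow_mul (by positivity),
      lt_rpow_inv_iff_of_pos (abs_nonneg v) (by positivity) hp0, rpow_two] at hv
    exact hv.le
  rcases le_total v 0 with hv0 | hv0
  · exact isCompact_and_isConnected_jointLevelSet hp0 hh hv0 hvh
  · obtain ⟨hc, hconn⟩ := isCompact_and_isConnected_jointLevelSet (v := -v) hp0 hh (by linarith)
      (by rwa [abs_neg])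
    rw [← neg_neg v, ← swap_image_jointLevelSet]
    exact ⟨hc.image continuous_swap, hconn.image _ continuous_swap.continuousOn⟩
end

section
/- The function x ↦ x·B(x,x) is convex on the open interval (1,2); in fact its second derivative is strictly positive there, so it is strictly convex on (1,2). -/
open Real

/-- The Euler Beta function `B(α,β) = ∫₀¹ t^(α−1)(1−t)^(β−1) dt`. -/
noncomputable def eulerBeta (a b : ℝ) : ℝ :=
  ∫ t in (0:ℝ)..1, t ^ (a - 1) * (1 - t) ^ (b - 1)

open MeasureTheory ProbabilityTheory Set

section LogGamma

lemma hasDerivAt_log_Gamma {x : ℝ} (hx : 0 < x) :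
    HasDerivAt (log ∘ Gamma) (deriv (log ∘ Gamma) x) x := by
  apply DifferentiableAt.hasDerivAt
  refine (differentiableAt_log (Gamma_pos_of_pos hx).ne').comp x (differentiableAt_Gamma fun m => ?_)
  have : (0 : ℝ) ≤ m := m.cast_nonneg
  linarith

lemma deriv_log_Gamma_add_one {x : ℝ} (hx : 0 < x) :
    deriv (log ∘ Gamma) (x + 1) = deriv (log ∘ Gamma) x + 1 / x := by
  have h1 : HasDerivAt (fun y => (log ∘ Gamma) (y + 1)) (deriv (log ∘ Gamma) (x + 1)) x :=
    (hasDerivAt_log_Gamma (by linarith)).comp_add_const x 1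
  have h2 : HasDerivAt (fun y => (log ∘ Gamma) y + log y)
      (deriv (log ∘ Gamma) x + 1 / x) x := by
    rw [one_div]
    exact (hasDerivAt_log_Gamma hx).add (hasDerivAt_log hx.ne')
  refine h1.unique (h2.congr_of_eventuallyEq ?_)
  filter_upwards [eventually_gt_nhds hx] with y hy
  simp only [Function.comp_apply]
  rw [Gamma_add_one hy.ne', log_mul hy.ne' (Gamma_pos_of_pos hy).ne', add_comm]

lemma monotoneOn_deriv_log_Gamma : MonotoneOn (deriv (log ∘ Gamma)) (Ioi 0) :=
  convexOn_log_Gamma.monotoneOn_deriv fun _ hx => (hasDerivAt_log_Gamma hx).differentiableAt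

/-- A telescoping lower bound for partial sums of
`ψ (2 * x) - ψ x = ∑ x / ((n + x) * (n + 2 * x))`. -/
lemma telescoping_le_deriv_log_Gamma_sub {x : ℝ} (hx : 1 < x) (n : ℕ) :
    x * (1 / ((3 * x - 1) / 2) - 1 / ((3 * x - 1) / 2 + n)) +
        (deriv (log ∘ Gamma) (2 * x + n) - deriv (log ∘ Gamma) (x + n)) ≤
      deriv (log ∘ Gamma) (2 * x) - deriv (log ∘ Gamma) x := by
  induction n with
  | zero => simp
  | succ n ih =>
    have hn : (0 : ℝ) ≤ n := n.cast_nonneg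
    have h1 := deriv_log_Gamma_add_one (x := x + n) (by linarith)
    have h2 := deriv_log_Gamma_add_one (x := 2 * x + n) (by linarith)
    push_cast
    rw [← add_assoc, ← add_assoc, ← add_assoc, h1, h2]
    set c := (3 * x - 1) / 2 with hc
    have hc0 : 0 < c := by linarith
    have key : x * (1 / (c + n) - 1 / (c + n + 1)) ≤ 1 / (x + n) - 1 / (2 * x + n) := by
      have e1 : x * (1 / (c + n) - 1 / (c + n + 1)) = x / ((c + n) * (c + n + 1)) := by
        field_simp
        ring
      have e2 : 1 / (x + n) - 1 / (2 * x + n) = x / ((x + n) * (2 * x + n)) := by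
        have : x + n ≠ 0 := by positivity
        field_simp
        ring
      rw [e1, e2]
      apply div_le_div_of_nonneg_left (by linarith) (by positivity)
      rw [hc]
      nlinarith
    linarith

lemma one_lt_mul_deriv_log_Gamma_sub {x : ℝ} (hx : 1 < x) :
    1 < x * (deriv (log ∘ Gamma) (2 * x) - deriv (log ∘ Gamma) x) := by
  have hc : 0 < (3 * x - 1) / 2 := by linarith
  have hle : x * (1 / ((3 * x - 1) / 2)) ≤
      deriv (log ∘ Gamma) (2 * x) - deriv (log ∘ Gamma) x := by
    have hlim : Filter.Tendsto
        (fun n : ℕ => x * (1 / ((3 * x - 1) / 2) - 1 / ((3 * x - 1) / 2 + n))) Filter.atTop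
        (nhds (x * (1 / ((3 * x - 1) / 2) - 0))) := by
      refine (tendsto_const_nhds.sub ?_).const_mul x
      simp only [one_div]
      exact (Filter.tendsto_atTop_add_const_left _ _ tendsto_natCast_atTop_atTop).inv_tendsto_atTop
    rw [sub_zero] at hlim
    refine le_of_tendsto' hlim fun n => ?_
    have hn : (0 : ℝ) ≤ n := n.cast_nonneg
    have h1 := telescoping_le_deriv_log_Gamma_sub hx n
    have h2 := monotoneOn_deriv_log_Gamma (a := x + n) (b := 2 * x + n)
      (mem_Ioi.2 (by linarith)) (mem_Ioi.2 (by linarith)) (by linarith)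
    linarith
  refine lt_of_lt_of_le ?_ (mul_le_mul_of_nonneg_left hle (by linarith : 0 ≤ x))
  rw [mul_one_div, mul_div_assoc', lt_div_iff₀ hc]
  nlinarith

end LogGamma

section CentralBeta

lemma eulerBeta_eq_beta {x y : ℝ} (hx : 0 < x) (hy : 0 < y) : eulerBeta x y = beta x y := by
  rw [beta_eq_betaIntegralReal x y hx hy]
  have : Complex.betaIntegral x y = (eulerBeta x y : ℂ) := by
    rw [Complex.betaIntegral, eulerBeta, ← intervalIntegral.integral_ofReal]
    refine intervalIntegral.integral_congr fun t ht => ?_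
    rw [uIcc_of_le zero_le_one] at ht
    simp only [Complex.ofReal_mul]
    rw [Complex.ofReal_cpow ht.1, Complex.ofReal_cpow (sub_nonneg.2 ht.2)]
    push_cast
    rfl
  rw [this, Complex.ofReal_re]

/-- Under the uniform law on `(0, 1)`, the diagonal Beta function is a shifted moment generating
function of `log (t * (1 - t))`. -/
lemma eulerBeta_self_eq_mgf (x : ℝ) :
    eulerBeta x x =
      mgf (fun t : ℝ => log (t * (1 - t))) (volume.restrict (Ioo (0 : ℝ) 1)) (x - 1) := by
  rw [eulerBeta, intervalIntegral.integral_of_le zero_le_one, integral_Ioc_eq_integral_Ioo, mgf]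
  refine setIntegral_congr_fun measurableSet_Ioo fun t ht => ?_
  have h1 : 0 < 1 - t := sub_pos.2 ht.2
  rw [← mul_rpow ht.1.le h1.le, rpow_def_of_pos (mul_pos ht.1 h1), mul_comm (x - 1)]

lemma Ioi_subset_interior_integrableExpSet :
    Ioi 0 ⊆ interior (integrableExpSet (fun t : ℝ => log (t * (1 - t)))
      (volume.restrict (Ioo (0 : ℝ) 1))) := by
  refine interior_maximal (fun a ha => ?_) isOpen_Ioi
  have hmeas : Measurable fun t : ℝ => exp (a * log (t * (1 - t))) := by fun_prop
  refine Integrable.of_bound (C := 1) hmeas.aestronglyMeasurable ?_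
  filter_upwards [ae_restrict_mem measurableSet_Ioo] with t ht
  rw [norm_of_nonneg (exp_pos _).le, exp_le_one_iff]
  refine mul_nonpos_of_nonneg_of_nonpos (le_of_lt ha) (log_nonpos ?_ ?_) <;>
    nlinarith [ht.1, ht.2]

lemma log_eulerBeta_self {x : ℝ} (hx : 0 < x) :
    log (eulerBeta x x) = 2 * (log ∘ Gamma) x - (log ∘ Gamma) (2 * x) := by
  have h := (Gamma_pos_of_pos hx).ne'
  have h2 := (Gamma_pos_of_pos (show 0 < 2 * x by linarith)).ne'
  rw [eulerBeta_eq_beta hx hx, beta, ← two_mul, log_div (mul_ne_zero h h) h2, log_mul h h,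
    Function.comp_apply, Function.comp_apply]
  ring

lemma eulerBeta_self_pos {x : ℝ} (hx : 0 < x) : 0 < eulerBeta x x :=
  eulerBeta_eq_beta hx hx ▸ beta_pos hx hx

lemma hasDerivAt_log_eulerBeta_self {x : ℝ} (hx : 0 < x) :
    HasDerivAt (fun y => log (eulerBeta y y))
      (2 * deriv (log ∘ Gamma) x - 2 * deriv (log ∘ Gamma) (2 * x)) x := by
  have h1 := (hasDerivAt_log_Gamma hx).const_mul 2
  have h2 := (hasDerivAt_log_Gamma (show 0 < 2 * x by linarith)).comp x
    ((hasDerivAt_id x).const_mul 2)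
  have h3 := h1.sub h2
  rw [mul_one, mul_comm _ (2 : ℝ)] at h3
  refine h3.congr_of_eventuallyEq ?_
  filter_upwards [eventually_gt_nhds hx] with y hy
  simpa using log_eulerBeta_self hy

lemma mul_deriv_eulerBeta_self_add_lt {x b' : ℝ} (hx : 1 < x)
    (hb : HasDerivAt (fun y => eulerBeta y y) b' x) : x * b' + 2 * eulerBeta x x < 0 := by
  have hpos := eulerBeta_self_pos (show 0 < x by linarith)
  have h := (hb.log hpos.ne').unique (hasDerivAt_log_eulerBeta_self (by linarith))
  rw [div_eq_iff hpos.ne'] at h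
  rw [h]
  nlinarith [mul_pos hpos (sub_pos.2 (one_lt_mul_deriv_log_Gamma_sub hx))]

/-- The diagonal Beta function is twice differentiable and log-convex on `(1, ∞)`. -/
lemma exists_deriv_eulerBeta_self : ∃ b₁ b₂ : ℝ → ℝ, ∀ x, 1 < x →
    HasDerivAt (fun y => eulerBeta y y) (b₁ x) x ∧ HasDerivAt b₁ (b₂ x) x ∧
      b₁ x ^ 2 ≤ eulerBeta x x * b₂ x := by
  set X : ℝ → ℝ := fun t => log (t * (1 - t))
  set μ : Measure ℝ := volume.restrict (Ioo (0 : ℝ) 1)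
  have hB : (fun y => eulerBeta y y) = fun y => mgf X μ (y - 1) :=
    funext eulerBeta_self_eq_mgf
  refine ⟨fun x => ∫ t, X t ^ 1 * exp ((x - 1) * X t) ∂μ,
    fun x => ∫ t, X t ^ 2 * exp ((x - 1) * X t) ∂μ, fun x hx => ?_⟩
  have hmem : x - 1 ∈ interior (integrableExpSet X μ) :=
    Ioi_subset_interior_integrableExpSet (sub_pos.2 hx)
  have hpos := eulerBeta_self_pos (show 0 < x by linarith)
  refine ⟨?_, (hasDerivAt_integral_pow_mul_exp_real hmem 1).comp_sub_const x 1, ?_⟩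
  · rw [hB]
    simpa using (hasDerivAt_mgf hmem).comp_sub_const x 1
  · rw [eulerBeta_self_eq_mgf] at hpos ⊢
    have h0 : 0 ≤ iteratedDeriv 2 (cgf X μ) (x - 1) := by
      rw [iteratedDeriv_two_cgf_eq_integral hmem]
      exact div_nonneg (integral_nonneg fun t => by positivity) hpos.le
    rw [iteratedDeriv_two_cgf hmem, deriv_cgf hmem, div_pow, sub_nonneg,
      div_le_div_iff₀ (by positivity) hpos] at h0
    simp only [pow_one]
    refine le_of_mul_le_mul_right (h0.trans_eq ?_) hpos
    ring

end CentralBeta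

lemma deriv_deriv_mul_eulerBeta_self_pos {x : ℝ} (hx : 1 < x) :
    0 < deriv (deriv (fun x => x * eulerBeta x x)) x := by
  obtain ⟨b₁, b₂, hb⟩ := exists_deriv_eulerBeta_self
  have h1 : ∀ y, 1 < y →
      HasDerivAt (fun x => x * eulerBeta x x) (eulerBeta y y + y * b₁ y) y := fun y hy =>
    ((hasDerivAt_id y).mul (hb y hy).1).congr_deriv (by simp)
  obtain ⟨hx1, hx2, hcs⟩ := hb x hx
  have h2 : HasDerivAt (fun y => eulerBeta y y + y * b₁ y) (b₁ x + (b₁ x + x * b₂ x)) x :=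
    (hx1.add ((hasDerivAt_id x).mul hx2)).congr_deriv (by simp)
  have h3 : deriv (fun x => x * eulerBeta x x) =ᶠ[nhds x] fun y => eulerBeta y y + y * b₁ y := by
    filter_upwards [eventually_gt_nhds hx] with y hy using (h1 y hy).deriv
  rw [h3.deriv_eq, h2.deriv]
  have hpos := eulerBeta_self_pos (show 0 < x by linarith)
  have hlt := mul_deriv_eulerBeta_self_add_lt hx hx1
  have hneg : b₁ x < 0 := by
    by_contra! h
    nlinarith
  refine pos_of_mul_pos_right (a := eulerBeta x x) ?_ hpos.le
  nlinarith [mul_pos_of_neg_of_neg hneg hlt, mul_le_mul_of_nonneg_left hcs (by linarith : 0 ≤ x)]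

/-- the function `x ↦ x·B(x,x)` is convex on `(1,2)`; in fact its
second derivative is strictly positive there, so it is strictly convex on `(1,2)`. -/
theorem xBeta_convex :
    ConvexOn ℝ (Set.Ioo (1 : ℝ) 2) (fun x => x * eulerBeta x x) ∧
    (∀ x ∈ Set.Ioo (1 : ℝ) 2, 0 < deriv (deriv (fun x => x * eulerBeta x x)) x) ∧
    StrictConvexOn ℝ (Set.Ioo (1 : ℝ) 2) (fun x => x * eulerBeta x x) := by
  have hpos : ∀ x ∈ Set.Ioo (1 : ℝ) 2, 0 < deriv (deriv (fun x => x * eulerBeta x x)) x :=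
    fun x hx => deriv_deriv_mul_eulerBeta_self_pos hx.1
  have hcont : ContinuousOn (fun x => x * eulerBeta x x) (Set.Ioo (1 : ℝ) 2) := by
    obtain ⟨b₁, b₂, hb⟩ := exists_deriv_eulerBeta_self
    exact continuousOn_id.mul fun x hx => (hb x hx.1).1.continuousAt.continuousWithinAt
  have hstrict := strictConvexOn_of_deriv2_pos' (convex_Ioo 1 2) hcont hpos
  exact ⟨hstrict.convexOn, hpos, hstrict⟩
end

section
/- For every real x with 1 < x < 2, the following chain of inequalities holds: x·B(x,x) ≤ 5/3 − 2x/3 ≤ 4/(1 + 2^(1/(x−1)))^(2(x−1)). In particular, setting x = 2/p with 1 ≤ p < 2, one obtains (1/p)·B(2/p, 2/p) ≤ (1/2)·(2^(p/(2−p))/(1 + 2^(p/(2−p))))^(2(2/p − 1)). -/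
open Real

theorem four_rpow_mul_eulerBeta_le {s : ℝ} (h0 : 0 ≤ s) (h1 : s ≤ 1) :
    (4 : ℝ) ^ s * eulerBeta (s + 1) (s + 1) ≤ 1 - s / 3 := by
  have hint : ∫ t in (0:ℝ)..1, (1 - s * (1 - 2 * t) ^ 2) = 1 - s / 3 := by
    have hd : ∀ t ∈ Set.uIcc (0:ℝ) 1,
        HasDerivAt (fun t : ℝ => t + s * (1 - 2 * t) ^ 3 / 6) (1 - s * (1 - 2 * t) ^ 2) t := by
      intro t _
      have h := (hasDerivAt_id t).add
        ((((((hasDerivAt_id t).const_mul 2).const_sub 1).pow 3).const_mul s).div_const 6)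
      refine h.congr_deriv ?_
      simp
      ring
    rw [intervalIntegral.integral_eq_sub_of_hasDerivAt hd
      (Continuous.intervalIntegrable (by fun_prop) _ _)]
    norm_num
    ring
  rw [eulerBeta, ← intervalIntegral.integral_const_mul, ← hint]
  simp only [add_sub_cancel_right]
  refine intervalIntegral.integral_mono_on zero_le_one ?_ ?_ ?_
  · exact Continuous.intervalIntegrable
      (continuous_const.mul ((continuous_id.rpow_const fun _ => Or.inr h0).mul
        ((continuous_const.sub continuous_id).rpow_const fun _ => Or.inr h0))) _ _
  · exact Continuous.intervalIntegrable (by fun_prop) _ _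
  · rintro t ⟨ht0, ht1⟩
    have ht1' : 0 ≤ 1 - t := by linarith
    rw [← mul_rpow ht0 ht1', ← mul_rpow (by norm_num) (by positivity)]
    have hq : 4 * (t * (1 - t)) = 1 + -(1 - 2 * t) ^ 2 := by ring
    rw [hq]
    have := rpow_one_add_le_one_add_mul_self (s := -(1 - 2 * t) ^ 2) (by nlinarith) h0 h1
    linarith

theorem le_four_rpow_mul {s : ℝ} (h0 : 0 ≤ s) (h1 : s ≤ 1) :
    (1 + s) * (3 - s) ≤ (4 : ℝ) ^ s * (3 - 2 * s) := by
  rcases le_total s (1 / 2) with hs | hs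
  · have hL : (1.386 : ℝ) ≤ log 4 := by
      have : log 4 = 2 * log 2 := by
        rw [show (4 : ℝ) = 2 ^ 2 by norm_num, log_pow]
        norm_num
      linarith [log_two_gt_d9]
    have hy : 1.386 * s ≤ log 4 * s := mul_le_mul_of_nonneg_right hL h0
    have hexp : 1 + 1.386 * s + (1.386 * s) ^ 2 / 2 ≤ (4 : ℝ) ^ s := by
      rw [rpow_def_of_pos (by norm_num)]
      exact (quadratic_le_exp_of_nonneg (by positivity)).trans (exp_le_exp.mpr hy)
    refine le_trans ?_ (mul_le_mul_of_nonneg_right hexp (by linarith))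
    nlinarith [mul_nonneg (sq_nonneg s) (sub_nonneg.mpr hs)]
  · have hr : (4 : ℝ) ^ (1 - s) ≤ 1 + 2 * (1 - s) := by
      rw [show (4 : ℝ) = 2 ^ (2 : ℝ) by norm_num, ← rpow_mul (by norm_num)]
      have := rpow_one_add_le_one_add_mul_self (s := 1) (p := 2 * (1 - s))
        (by norm_num) (by linarith) (by linarith)
      norm_num at this ⊢
      linarith
    have hmul : (4 : ℝ) ^ s * (4 : ℝ) ^ (1 - s) = 4 := by
      rw [← rpow_add (by norm_num)]
      norm_num
    have hpos : (0 : ℝ) < 4 ^ s := rpow_pos_of_pos (by norm_num) s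
    nlinarith [mul_le_mul_of_nonneg_left hr hpos.le, sq_nonneg (1 - s)]

theorem mul_eulerBeta_self_le {x : ℝ} (h1 : 1 ≤ x) (h2 : x ≤ 2) :
    x * eulerBeta x x ≤ 5 / 3 - 2 * x / 3 := by
  have hB := four_rpow_mul_eulerBeta_le (sub_nonneg.mpr h1) (by linarith)
  have hF := le_four_rpow_mul (sub_nonneg.mpr h1) (by linarith)
  rw [sub_add_cancel] at hB
  have hpos : (0 : ℝ) < 4 ^ (x - 1) := rpow_pos_of_pos (by norm_num) _
  refine le_of_mul_le_mul_left ?_ hpos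
  nlinarith [mul_le_mul_of_nonneg_left hB (by linarith : 0 ≤ x)]

theorem one_add_two_rpow_neg_inv_rpow_le {s : ℝ} (h0 : 0 < s) (h1 : s ≤ 1) :
    (1 + (2 : ℝ) ^ (-(1 / s))) ^ (2 * s) * (3 - 2 * s) ≤ 3 := by
  have hb0 : (0 : ℝ) < 2 ^ (-(1 / s)) := rpow_pos_of_pos (by norm_num) _
  rcases le_total s (1 / 2) with hs | hs
  · have hb : (2 : ℝ) ^ (-(1 / s)) ≤ 1 / 4 := by
      have h2 : (2 : ℝ) ≤ 1 / s := by
        rw [le_div_iff₀ h0]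
        linarith
      calc (2 : ℝ) ^ (-(1 / s)) ≤ 2 ^ (-2 : ℝ) :=
            rpow_le_rpow_of_exponent_le (by norm_num) (by linarith)
        _ = 1 / 4 := by rw [rpow_neg (by norm_num)]; norm_num
    have := rpow_one_add_le_one_add_mul_self (s := (2 : ℝ) ^ (-(1 / s))) (p := 2 * s)
      (by linarith) (by linarith) (by linarith)
    have h3 : (1 + (2 : ℝ) ^ (-(1 / s))) ^ (2 * s) ≤ 1 + 2 * s * (1 / 4) :=
      this.trans (by gcongr)
    nlinarith [mul_le_mul_of_nonneg_right h3 (by linarith : 0 ≤ 3 - 2 * s)]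
  · have hb : (2 : ℝ) ^ (-(1 / s)) ≤ 1 / 2 := by
      have h2 : (1 : ℝ) ≤ 1 / s := by
        rw [le_div_iff₀ h0]
        linarith
      calc (2 : ℝ) ^ (-(1 / s)) ≤ 2 ^ (-1 : ℝ) :=
            rpow_le_rpow_of_exponent_le (by norm_num) (by linarith)
        _ = 1 / 2 := by rw [rpow_neg (by norm_num)]; norm_num
    have h3 : (1 + (2 : ℝ) ^ (-(1 / s))) ^ (2 * s) ≤ (1 + 1 / 2) ^ (2 * s) := by gcongr
    have h4 := rpow_one_add_le_one_add_mul_self (s := 1 / 2) (p := 2 * s - 1)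
      (by norm_num) (by linarith) (by linarith)
    rw [rpow_sub_one (by norm_num), div_le_iff₀ (by norm_num)] at h4
    nlinarith [mul_le_mul_of_nonneg_right (h3.trans h4) (by linarith : 0 ≤ 3 - 2 * s),
      sq_nonneg (2 * s - 1)]

theorem two_rpow_inv_div_rpow_eq {s : ℝ} (h0 : 0 < s) :
    ((2 : ℝ) ^ (1 / s) / (1 + 2 ^ (1 / s))) ^ (2 * s) =
      4 / (1 + (2 : ℝ) ^ (1 / s)) ^ (2 * s) := by
  rw [div_rpow (by positivity) (by positivity), ← rpow_mul (by norm_num),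
    show 1 / s * (2 * s) = 2 by field_simp]
  norm_num

theorem le_four_div_one_add_two_rpow {x : ℝ} (h1 : 1 < x) (h2 : x ≤ 2) :
    5 / 3 - 2 * x / 3 ≤ 4 / (1 + (2 : ℝ) ^ (1 / (x - 1))) ^ (2 * (x - 1)) := by
  have h0 : 0 < x - 1 := sub_pos.mpr h1
  have h := one_add_two_rpow_neg_inv_rpow_le h0 (by linarith)
  have ha : (0 : ℝ) < 2 ^ (1 / (x - 1)) := rpow_pos_of_pos (by norm_num) _
  have hinv : (2 : ℝ) ^ (1 / (x - 1)) / (1 + 2 ^ (1 / (x - 1))) =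
      (1 + 2 ^ (-(1 / (x - 1))))⁻¹ := by
    rw [rpow_neg (by norm_num)]
    field_simp
    ring
  rw [← two_rpow_inv_div_rpow_eq h0, hinv, inv_rpow (by positivity), ← one_div,
    le_div_iff₀ (by positivity)]
  linarith

/-- for `1 < x < 2`,
`x·B(x,x) ≤ 5/3 − 2x/3 ≤ 4/(1 + 2^(1/(x−1)))^(2(x−1))`; in particular, for
`x = 2/p` with `1 ≤ p < 2`,
`(1/p)·B(2/p,2/p) ≤ (1/2)·(2^(p/(2−p))/(1 + 2^(p/(2−p))))^(2(2/p − 1))`. -/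
theorem xBeta_chain_of_inequalities :
    (∀ x : ℝ, 1 < x → x < 2 →
      x * eulerBeta x x ≤ 5 / 3 - 2 * x / 3 ∧
      5 / 3 - 2 * x / 3 ≤ 4 / (1 + (2 : ℝ) ^ (1 / (x - 1))) ^ (2 * (x - 1))) ∧
    (∀ p : ℝ, 1 ≤ p → p < 2 →
      (1 / p) * eulerBeta (2 / p) (2 / p) ≤
        (1 / 2) * ((2 : ℝ) ^ (p / (2 - p)) / (1 + (2 : ℝ) ^ (p / (2 - p)))) ^
          (2 * (2 / p - 1))) := by
  refine ⟨fun x h1 h2 => ⟨mul_eulerBeta_self_le h1.le h2.le,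
    le_four_div_one_add_two_rpow h1 h2.le⟩, fun p h1 h2 => ?_⟩
  have hp : 0 < p := by linarith
  have hx1 : 1 < 2 / p := by rwa [one_lt_div hp]
  have hx2 : 2 / p ≤ 2 := by
    rw [div_le_iff₀ hp]
    linarith
  have hs : p / (2 - p) = 1 / (2 / p - 1) := by
    have : 2 - p ≠ 0 := by linarith
    field_simp
  rw [hs, two_rpow_inv_div_rpow_eq (sub_pos.mpr hx1)]
  have h := (mul_eulerBeta_self_le hx1.le hx2).trans (le_four_div_one_add_two_rpow hx1 hx2)
  have hhalf : 1 / p * eulerBeta (2 / p) (2 / p) =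
      1 / 2 * (2 / p * eulerBeta (2 / p) (2 / p)) := by ring
  rw [hhalf]
  exact mul_le_mul_of_nonneg_left h (by norm_num)
end

section
/- For every real p with 1 ≤ p < 2, one has (1/2)^((2−p)/p) + (4^(p/(2−p))/(1 + 4^(p/(2−p))))^((2−p)/p) ≤ 2·(2^(p/(2−p))/(1 + 2^(p/(2−p))))^((2−p)/p). -/
open Real

/-- Midpoint concavity of `t ↦ t ^ s` for `0 ≤ s ≤ 1`. -/
lemma rpow_add_rpow_le_two_mul_rpow {a b c s : ℝ} (ha : 0 ≤ a) (hb : 0 ≤ b)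
    (hs0 : 0 ≤ s) (hs1 : s ≤ 1) (h : a + b ≤ 2 * c) :
    a ^ s + b ^ s ≤ 2 * c ^ s := by
  have hconc := (concaveOn_rpow hs0 hs1).2 (Set.mem_Ici.2 ha) (Set.mem_Ici.2 hb)
    (by norm_num : (0 : ℝ) ≤ 1 / 2) (by norm_num : (0 : ℝ) ≤ 1 / 2) (by norm_num)
  simp only [smul_eq_mul] at hconc
  have hmono : (1 / 2 * a + 1 / 2 * b) ^ s ≤ c ^ s :=
    rpow_le_rpow (by positivity) (by linarith) hs0
  linarith

lemma half_add_sq_div_one_add_sq_le {x : ℝ} (hx : 1 ≤ x) :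
    1 / 2 + x ^ 2 / (1 + x ^ 2) ≤ 2 * (x / (1 + x)) := by
  have key : 2 * (x / (1 + x)) - (1 / 2 + x ^ 2 / (1 + x ^ 2)) =
      (x - 1) ^ 3 / (2 * (1 + x) * (1 + x ^ 2)) := by
    have : 1 + x ≠ 0 := by positivity
    field_simp
    ring
  have : 0 ≤ (x - 1) ^ 3 / (2 * (1 + x) * (1 + x ^ 2)) :=
    div_nonneg (pow_nonneg (by linarith) 3) (by positivity)
  linarith

/-- for `1 ≤ p < 2`,
`(1/2)^((2−p)/p) + (4^(p/(2−p))/(1 + 4^(p/(2−p))))^((2−p)/p)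
  ≤ 2·(2^(p/(2−p))/(1 + 2^(p/(2−p))))^((2−p)/p)`. -/
theorem x_intercepts_inequality (p : ℝ) (hp1 : 1 ≤ p) (hp2 : p < 2) :
    (1 / 2 : ℝ) ^ ((2 - p) / p) +
      ((4 : ℝ) ^ (p / (2 - p)) / (1 + (4 : ℝ) ^ (p / (2 - p)))) ^ ((2 - p) / p) ≤
    2 * ((2 : ℝ) ^ (p / (2 - p)) / (1 + (2 : ℝ) ^ (p / (2 - p)))) ^ ((2 - p) / p) := by
  have hp : 0 < p := by linarith
  have h2p : 0 < 2 - p := by linarith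
  have hfour : (4 : ℝ) ^ (p / (2 - p)) = ((2 : ℝ) ^ (p / (2 - p))) ^ 2 := by
    rw [show (4 : ℝ) = 2 * 2 by norm_num, mul_rpow (by norm_num) (by norm_num), sq]
  have hx : 1 ≤ (2 : ℝ) ^ (p / (2 - p)) := one_le_rpow (by norm_num) (by positivity)
  rw [hfour]
  exact rpow_add_rpow_le_two_mul_rpow (by norm_num) (by positivity) (by positivity)
    ((div_le_one hp).2 (by linarith)) (half_add_sq_div_one_add_sq_le hx)
end
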